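/- arXiv:1308.2420 — 3 statements merged into one kernel-verified Lean document; each statement's English description precedes it below -/
import Mathlib

section
/- For all integers n, r ≥ 2, the variety C_r(N_n) is irreducible in the Zariski topology if and only if C_r(N_n) = N_n^r; in particular, if C_r(N_n) is irreducible then dim C_r(N_n) = n² − n + (r−1)(n−1). -/
open MvPolynomial Matrix TopologicalSpace

/-- The Zariski topology on `r`-tuples of `n × n` matrices over `k`, identified with
affine space `k^(r·n²)`: the topology generated by complements of hypersurfaces
(its closed sets are exactly the common zero loci of families of polynomials in the
matrix entries). -/
noncomputable def matTupleZariski (k : Type*) [CommRing k] (n r : ℕ) :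
    TopologicalSpace (Fin r → Matrix (Fin n) (Fin n) k) :=
  TopologicalSpace.generateFrom
    {U | ∃ p : MvPolynomial (Fin r × Fin n × Fin n) k,
      U = {x | MvPolynomial.eval (fun q => x q.1 q.2.1 q.2.2) p ≠ 0}}

/-- `C_r(N_n)`: the set of commuting `r`-tuples of nilpotent `n × n` matrices. -/
def nilCommTuples (k : Type*) [Field k] (n r : ℕ) :
    Set (Fin r → Matrix (Fin n) (Fin n) k) :=
  {x | (∀ i, IsNilpotent (x i)) ∧ ∀ i j, x i * x j = x j * x i}

/-- `N_n^r`: the Zariski closure of the set of commuting nilpotent `r`-tuples whose first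
entry is regular nilpotent (nilpotent with `x^(n-1) ≠ 0`). -/
noncomputable def Nnr (k : Type*) [Field k] (n r : ℕ) :
    Set (Fin r → Matrix (Fin n) (Fin n) k) :=
  letI := matTupleZariski k n r
  closure {x | x ∈ nilCommTuples k n r ∧ ∀ i : Fin r, (i : ℕ) = 0 → (x i) ^ (n - 1) ≠ 0}

theorem ringKrullDim_eq_of_isIntegral_of_injective {R S : Type*} [CommRing R] [CommRing S]
    [Algebra R S] [Algebra.IsIntegral R S] (h : Function.Injective (algebraMap R S)) :
    ringKrullDim S = ringKrullDim R := by
  refine le_antisymm (Order.krullDim_le_of_strictMono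
    (PrimeSpectrum.comap (algebraMap R S)) fun _ _ h ↦ Ideal.IsIntegral.comap_lt_comap h) ?_
  refine iSup_le fun l ↦ ?_
  obtain ⟨P, hP⟩ : ∃ P, PrimeSpectrum.comap (algebraMap R S) P = l.head := by
    have : FaithfulSMul R S := (faithfulSMul_iff_algebraMap_injective R S).mpr h
    exact Algebra.IsIntegral.comap_surjective R S l.head
  have : P.asIdeal.LiesOver l.head.asIdeal := ⟨by rw [← hP]; rfl⟩
  obtain ⟨L, hL, -⟩ := Ideal.exists_ltSeries_of_hasGoingUp l P.asIdeal
  rw [← hL]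
  exact Order.LTSeries.length_le_krullDim L

theorem ringKrullDim_eq_of_isTranscendenceBasis {k A ι : Type*} [Field k] [CommRing A] [IsDomain A]
    [Algebra k A] [Algebra.FiniteType k A] [Finite ι] {x : ι → A} (hx : IsTranscendenceBasis k x) :
    ringKrullDim A = Nat.card ι := by
  obtain ⟨s, g, hg, hg'⟩ := exists_integral_inj_algHom_of_fg k A
  algebraize [g.toRingHom]
  have : Algebra.IsIntegral (MvPolynomial (Fin s) k) A := ⟨hg'⟩
  have : FaithfulSMul (MvPolynomial (Fin s) k) A :=
    (faithfulSMul_iff_algebraMap_injective _ _).mpr hg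
  have hX := (IsTranscendenceBasis.mvPolynomial (Fin s) k).algebraMap_comp (A := A)
  have hcard := congrArg Cardinal.toNat (hX.lift_cardinalMk_eq hx)
  simp only [Cardinal.toNat_lift] at hcard
  rw [ringKrullDim_eq_of_isIntegral_of_injective (R := MvPolynomial (Fin s) k) (S := A) hg,
    MvPolynomial.ringKrullDim_of_isNoetherianRing, ringKrullDim_eq_zero_of_field, zero_add]
  exact congrArg _ hcard

open Topology Set in
theorem Topology.IsInducing.topologicalKrullDim_eq_of_closedPoints_subset_range {X Y : Type*}
    [TopologicalSpace X] [TopologicalSpace Y] [JacobsonSpace Y] {f : X → Y} (hf : IsInducing f)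
    (h : closedPoints Y ⊆ range f) : topologicalKrullDim X = topologicalKrullDim Y := by
  refine le_antisymm hf.topologicalKrullDim_le ?_
  have key (Z : TopologicalSpace.IrreducibleCloseds Y) : IsIrreducible (f ⁻¹' Z) := by
    constructor
    · obtain ⟨y, hy, hy'⟩ := nonempty_inter_closedPoints Z.isIrreducible.nonempty
        Z.isClosed.isLocallyClosed
      obtain ⟨x, rfl⟩ := h hy'
      exact ⟨x, hy⟩
    · rintro u v hu hv ⟨x, hxZ, hxu⟩ ⟨x', hxZ', hxv⟩
      obtain ⟨U, hU, rfl⟩ := hf.isOpen_iff.mp hu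
      obtain ⟨V, hV, rfl⟩ := hf.isOpen_iff.mp hv
      obtain ⟨y, hy, hy'⟩ := nonempty_inter_closedPoints
        (Z.isIrreducible.isPreirreducible U V hU hV ⟨_, hxZ, hxu⟩ ⟨_, hxZ', hxv⟩)
        (Z.isClosed.isLocallyClosed.inter (hU.inter hV).isLocallyClosed)
      obtain ⟨x, rfl⟩ := h hy'
      exact ⟨x, hy⟩
  refine Order.krullDim_le_of_strictMono
    (fun Z ↦ ⟨f ⁻¹' Z, key Z, Z.isClosed.preimage hf.continuous⟩) ?_
  refine Monotone.strictMono_of_injective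
    (fun Z W (hZ : (Z : Set Y) ⊆ W) x (hx : f x ∈ (Z : Set Y)) ↦ hZ hx) fun Z W hZW ↦ ?_
  have hpre : f ⁻¹' Z = f ⁻¹' W := congrArg (fun T ↦ T.carrier) hZW
  have hcl (Z : TopologicalSpace.IrreducibleCloseds Y) :
      (Z : Set Y) = closure (f '' (f ⁻¹' Z) ∩ closedPoints Y) := by
    rw [image_preimage_eq_inter_range, inter_assoc, inter_eq_right.mpr h,
      JacobsonSpace.closure_inter_closedPoints_eq_closure Z.isClosed.isLocallyClosed,
      Z.isClosed.closure_eq]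
  exact TopologicalSpace.IrreducibleCloseds.ext (by rw [hcl Z, hcl W, hpre])

open Topology Set PrimeSpectrum in
theorem Topology.IsInducing.topologicalKrullDim_eq_ringKrullDim_quotient {X R : Type*}
    [TopologicalSpace X] [CommRing R] [IsJacobsonRing R] {f : X → PrimeSpectrum R}
    (hf : IsInducing f) (h : closedPoints (PrimeSpectrum R) ⊆ range f) {C : Set X}
    (hC : IsClosed C) :
    topologicalKrullDim C = ringKrullDim (R ⧸ vanishingIdeal (f '' C)) := by
  set I := vanishingIdeal (f '' C)
  have hemb := isClosedEmbedding_comap_of_surjective _ _ (Ideal.Quotient.mk_surjective (I := I))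
  have hrange : range (comap (Ideal.Quotient.mk I)) = closure (f '' C) := by
    rw [range_comap_of_surjective _ _ Ideal.Quotient.mk_surjective, Ideal.mk_ker,
      zeroLocus_vanishingIdeal_eq_closure]
  have hmem (x : C) : ∃ P, comap (Ideal.Quotient.mk I) P = f x := by
    rw [← mem_range, hrange]
    exact subset_closure ⟨x, x.2, rfl⟩
  choose g hg using hmem
  have hcomp : comap (Ideal.Quotient.mk I) ∘ g = f ∘ Subtype.val := funext hg
  have hgi : IsInducing g := by
    rw [← hemb.isInducing.of_comp_iff, hcomp]
    exact hf.comp .subtypeVal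
  rw [hgi.topologicalKrullDim_eq_of_closedPoints_subset_range, topologicalKrullDim_eq_ringKrullDim]
  intro P hP
  have hP' : comap (Ideal.Quotient.mk I) P ∈ closedPoints (PrimeSpectrum R) := by
    rw [← hemb.preimage_closedPoints] at hP
    exact hP
  obtain ⟨x, hx⟩ := h hP'
  have hxC : x ∈ C := by
    rw [← hC.closure_eq, hf.closure_eq_preimage_closure_image, mem_preimage, hx, ← hrange]
    exact mem_range_self P
  exact ⟨⟨x, hxC⟩, hemb.injective ((hg ⟨x, hxC⟩).trans hx)⟩

open Topology Set in
theorem Topology.IsInducing.isIrreducible_of_image {X Y : Type*}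
    [TopologicalSpace X] [TopologicalSpace Y] {f : X → Y} (hf : IsInducing f) {s : Set X}
    (h : IsIrreducible (f '' s)) : IsIrreducible s := by
  refine ⟨image_nonempty.mp h.nonempty, ?_⟩
  rintro u v hu hv ⟨x, hxs, hxu⟩ ⟨y, hys, hyv⟩
  obtain ⟨U, hU, rfl⟩ := hf.isOpen_iff.mp hu
  obtain ⟨V, hV, rfl⟩ := hf.isOpen_iff.mp hv
  obtain ⟨_, ⟨z, hz, rfl⟩, hzUV⟩ :=
    h.isPreirreducible U V hU hV ⟨f x, ⟨x, hxs, rfl⟩, hxu⟩ ⟨f y, ⟨y, hys, rfl⟩, hyv⟩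
  exact ⟨z, hz, hzUV⟩

section Krylov

variable {B B' : Type*} [CommRing B] [CommRing B'] {m : ℕ}

/-- The nilpotent Jordan block with ones below the diagonal. -/
def lowerShift (B : Type*) [CommRing B] (m : ℕ) : Matrix (Fin (m + 1)) (Fin (m + 1)) B :=
  .of fun a b ↦ if (a : ℕ) = b + 1 then 1 else 0

/-- The Krylov matrix of `x` and `v`, with columns `v, x v, …, x ^ m v`. -/
def krylov (x : Matrix (Fin (m + 1)) (Fin (m + 1)) B) (v : Fin (m + 1) → B) :
    Matrix (Fin (m + 1)) (Fin (m + 1)) B :=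
  .of fun a j ↦ ((x ^ (j : ℕ)) *ᵥ v) a

theorem lowerShift_pow_apply (l : ℕ) (a b : Fin (m + 1)) :
    (lowerShift B m ^ l) a b = if (a : ℕ) = b + l then 1 else 0 := by
  induction l generalizing b with
  | zero => simp [Matrix.one_apply, Fin.ext_iff]
  | succ l ih =>
    rw [pow_succ, Matrix.mul_apply]
    simp only [ih]
    simp only [lowerShift, of_apply, mul_ite, mul_one, mul_zero]
    by_cases h : (b : ℕ) + 1 < m + 1
    · rw [Finset.sum_eq_single ⟨b + 1, h⟩]
      · simp [add_assoc, add_comm 1 l]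
      · intro c _ hc
        exact if_neg fun h' ↦ hc (Fin.ext h')
      · simp
    · rw [Finset.sum_eq_zero, if_neg]
      · omega
      · intro c _
        exact if_neg (by omega)

theorem lowerShift_pow_eq_zero : lowerShift B m ^ (m + 1) = 0 := by
  ext a b
  rw [lowerShift_pow_apply, if_neg (by omega), Matrix.zero_apply]

theorem mul_krylov {x : Matrix (Fin (m + 1)) (Fin (m + 1)) B} (hx : x ^ (m + 1) = 0)
    (v : Fin (m + 1) → B) : x * krylov x v = krylov x v * lowerShift B m := by
  ext a j
  have hl : (x * krylov x v) a j = ((x ^ ((j : ℕ) + 1)) *ᵥ v) a := by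
    rw [pow_succ', ← mulVec_mulVec]; rfl
  rw [hl, Matrix.mul_apply]
  simp only [lowerShift, krylov, of_apply, mul_ite, mul_one, mul_zero]
  by_cases h : (j : ℕ) + 1 < m + 1
  · rw [Finset.sum_eq_single ⟨j + 1, h⟩]
    · simp
    · intro c _ hc
      exact if_neg fun h' ↦ hc (Fin.ext h')
    · simp
  · rw [Finset.sum_eq_zero, show (j : ℕ) + 1 = m + 1 by omega, hx]
    · simp
    · intro c _
      exact if_neg (by omega)

theorem krylov_mulVec (x : Matrix (Fin (m + 1)) (Fin (m + 1)) B) (v c : Fin (m + 1) → B) :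
    krylov x v *ᵥ c = (∑ l, c l • x ^ (l : ℕ)) *ᵥ v := by
  rw [Matrix.sum_mulVec]
  ext a
  simp [mulVec, dotProduct, krylov, Matrix.smul_apply, mul_comm, Finset.mul_sum, mul_left_comm,
    Finset.sum_apply]

theorem eq_sum_pow_of_commute {x y : Matrix (Fin (m + 1)) (Fin (m + 1)) B} (hxy : Commute x y)
    {v c : Fin (m + 1) → B} (hdet : IsUnit (krylov x v).det) (hc : y *ᵥ v = krylov x v *ᵥ c) :
    y = ∑ l, c l • x ^ (l : ℕ) := by
  rw [krylov_mulVec] at hc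
  set p := ∑ l, c l • x ^ (l : ℕ) with hp
  have hxp : Commute x p := .sum_right _ _ _ fun l _ ↦ ((Commute.refl x).pow_right _).smul_right _
  have hmul : y * krylov x v = p * krylov x v := by
    ext a j
    change (y *ᵥ ((x ^ (j : ℕ)) *ᵥ v)) a = (p *ᵥ ((x ^ (j : ℕ)) *ᵥ v)) a
    rw [mulVec_mulVec, mulVec_mulVec, ← (hxy.pow_left _).eq, ← (hxp.pow_left _).eq,
      ← mulVec_mulVec, ← mulVec_mulVec, hc]
  exact ((isUnit_iff_isUnit_det _).mpr hdet).mul_right_cancel hmul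

theorem eq_sum_pow_succ_of_commute [IsReduced B] {x y : Matrix (Fin (m + 1)) (Fin (m + 1)) B}
    (hxy : Commute x y) (hx : IsNilpotent x) (hy : IsNilpotent y)
    {v c : Fin (m + 1) → B} (hdet : IsUnit (krylov x v).det) (hc : y *ᵥ v = krylov x v *ᵥ c) :
    y = ∑ l : Fin m, c l.succ • x ^ (l + 1 : ℕ) := by
  have h := eq_sum_pow_of_commute hxy hdet hc
  rw [Fin.sum_univ_succ] at h
  simp only [Fin.val_zero, pow_zero, Fin.val_succ] at h
  set q := ∑ l : Fin m, c l.succ • x ^ (l + 1 : ℕ) with hq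
  have hqx : q = x * ∑ l : Fin m, c l.succ • x ^ (l : ℕ) := by
    simp_rw [hq, Finset.mul_sum, mul_smul_comm, pow_succ']
  have hqn : IsNilpotent q := by
    rw [hqx]
    refine Commute.isNilpotent_mul_right ?_ hx
    exact .sum_right _ _ _ fun l _ ↦ ((Commute.refl x).pow_right _).smul_right _
  have hyq : Commute y q :=
    .sum_right _ _ _ fun l _ ↦ (hxy.symm.pow_right _).smul_right _
  have h0 : IsNilpotent (c 0 • (1 : Matrix (Fin (m + 1)) (Fin (m + 1)) B)) := by
    rw [eq_sub_iff_add_eq.mpr h.symm]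
    exact hyq.isNilpotent_sub hy hqn
  obtain ⟨N, hN⟩ := h0
  rw [smul_pow, one_pow] at hN
  have hc0 : c 0 ^ N = 0 := by simpa using congrFun (congrFun hN 0) 0
  rw [h, (IsNilpotent.eq_zero ⟨N, hc0⟩ : c 0 = 0), zero_smul, zero_add]

theorem det_krylov_ne_zero [IsDomain B] {x : Matrix (Fin (m + 1)) (Fin (m + 1)) B}
    (hx : x ^ (m + 1) = 0) {v : Fin (m + 1) → B} (hv : (x ^ m) *ᵥ v ≠ 0) :
    (krylov x v).det ≠ 0 := by
  intro hdet
  obtain ⟨c, hc, h⟩ := exists_mulVec_eq_zero_iff.mpr hdet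
  refine hc (funext fun l ↦ ?_)
  induction l using WellFoundedLT.induction with
  | ind l ih =>
    have h2 := congrArg (fun w ↦ (x ^ (m - l)) *ᵥ w) h
    simp only [krylov_mulVec, mulVec_mulVec, mulVec_zero, Finset.mul_sum, mul_smul_comm,
      ← pow_add] at h2
    rw [Finset.sum_eq_single l, Nat.sub_add_cancel (by omega), smul_mulVec] at h2
    · exact (smul_eq_zero.mp h2).resolve_right hv
    · intro j _ hj
      rcases lt_or_gt_of_ne hj with hj | hj
      · rw [ih j hj, Pi.zero_apply, zero_smul]
      · rw [pow_eq_zero_of_le (by omega) hx, smul_zero]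
    · simp

theorem map_krylov (f : B →+* B') (x : Matrix (Fin (m + 1)) (Fin (m + 1)) B)
    (v : Fin (m + 1) → B) : f.mapMatrix (krylov x v) = krylov (f.mapMatrix x) (f ∘ v) := by
  ext a j
  simp only [krylov, RingHom.mapMatrix_apply, map_apply, of_apply]
  rw [RingHom.map_mulVec, ← RingHom.mapMatrix_apply, map_pow]
  rfl

theorem krylov_lowerShift (g : Matrix (Fin (m + 1)) (Fin (m + 1)) B) (hg : IsUnit g.det) :
    krylov (g * lowerShift B m * g⁻¹) (g *ᵥ Pi.single 0 1) = g := by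
  have hpow (l : ℕ) : (g * lowerShift B m * g⁻¹) ^ l * g = g * lowerShift B m ^ l := by
    induction l with
    | zero => simp
    | succ l ih =>
      rw [pow_succ, mul_assoc, nonsing_inv_mul_cancel_right _ _ hg, ← mul_assoc, ih, pow_succ,
        mul_assoc]
  ext a j
  simp only [krylov, of_apply, mulVec_mulVec, hpow]
  rw [mulVec_single_one, col_apply, Matrix.mul_apply, Finset.sum_eq_single j]
  · simp [lowerShift_pow_apply]
  · intro c _ hc
    rw [lowerShift_pow_apply, if_neg, mul_zero]
    simpa [Fin.ext_iff] using hc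
  · simp

end Krylov

section Parametrization

variable {k K : Type*} [Field k] [Field K] {B B' : Type*} [CommRing B] [CommRing B'] {m s : ℕ}

theorem Matrix.pow_card_eq_zero_of_isNilpotent {x : Matrix (Fin (m + 1)) (Fin (m + 1)) k}
    (hx : IsNilpotent x) : x ^ (m + 1) = 0 := by
  have h : x.charpoly = Polynomial.X ^ (m + 1) := by
    simpa [sub_eq_zero] using (isNilpotent_charpoly_sub_pow_of_isNilpotent hx).eq_zero
  simpa [h] using aeval_self_charpoly x

theorem eq_conj_lowerShift {x : Matrix (Fin (m + 1)) (Fin (m + 1)) k} (hx : IsNilpotent x)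
    {v : Fin (m + 1) → k} (hdet : (krylov x v).det ≠ 0) :
    x = (krylov x v).det⁻¹ • (krylov x v * lowerShift k m * (krylov x v).adjugate) := by
  rw [← mul_krylov (pow_card_eq_zero_of_isNilpotent hx), mul_assoc, mul_adjugate, mul_smul_comm,
    mul_one, smul_smul, inv_mul_cancel₀ hdet, one_smul]

theorem eq_sum_adjugate_krylov {x y : Matrix (Fin (m + 1)) (Fin (m + 1)) k} (hxy : Commute x y)
    (hx : IsNilpotent x) (hy : IsNilpotent y) {v : Fin (m + 1) → k}
    (hdet : (krylov x v).det ≠ 0) :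
    y = ∑ l : Fin m, ((krylov x v).det⁻¹ * ((krylov x v).adjugate *ᵥ (y *ᵥ v)) l.succ) •
      x ^ (l + 1 : ℕ) := by
  have hc : y *ᵥ v =
      krylov x v *ᵥ ((krylov x v).det⁻¹ • ((krylov x v).adjugate *ᵥ (y *ᵥ v))) := by
    rw [mulVec_smul, mulVec_mulVec (y *ᵥ v), mul_adjugate, smul_mulVec, one_mulVec, smul_smul,
      inv_mul_cancel₀ hdet, one_smul]
  exact eq_sum_pow_succ_of_commute hxy hx hy hdet.isUnit hc

/-- The conjugate `g J adj(g)` of the lower shift `J`, rescaled by `det g`. -/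
def scaledConj (g : Matrix (Fin (m + 1)) (Fin (m + 1)) B) : Matrix (Fin (m + 1)) (Fin (m + 1)) B :=
  g * lowerShift B m * g.adjugate

theorem scaledConj_pow_succ (g : Matrix (Fin (m + 1)) (Fin (m + 1)) B) (l : ℕ) :
    scaledConj g ^ (l + 1) = g.det ^ l • (g * lowerShift B m ^ (l + 1) * g.adjugate) := by
  induction l with
  | zero => simp [scaledConj]
  | succ l ih =>
    rw [pow_succ, ih, scaledConj, smul_mul_assoc, pow_succ (lowerShift B m) (l + 1)]
    simp only [mul_assoc]
    rw [← mul_assoc g.adjugate g, adjugate_mul, smul_mul_assoc, one_mul, mul_smul_comm,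
      mul_smul_comm, smul_smul, ← pow_succ]

theorem isNilpotent_scaledConj (g : Matrix (Fin (m + 1)) (Fin (m + 1)) B) :
    IsNilpotent (scaledConj g) :=
  ⟨m + 1, by rw [scaledConj_pow_succ, lowerShift_pow_eq_zero, mul_zero, zero_mul, smul_zero]⟩

theorem map_lowerShift (f : B →+* B') : f.mapMatrix (lowerShift B m) = lowerShift B' m := by
  ext a b
  simp [lowerShift, apply_ite f]

theorem map_scaledConj (f : B →+* B') (g : Matrix (Fin (m + 1)) (Fin (m + 1)) B) :
    f.mapMatrix (scaledConj g) = scaledConj (f.mapMatrix g) := by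
  rw [scaledConj, map_mul, map_mul, map_lowerShift, RingHom.map_adjugate, scaledConj]

theorem map_sum_smul_pow (f : B →+* B') (c : Fin m → B)
    (z : Matrix (Fin (m + 1)) (Fin (m + 1)) B) :
    f.mapMatrix (∑ l : Fin m, c l • z ^ (l + 1 : ℕ)) =
      ∑ l : Fin m, f (c l) • f.mapMatrix z ^ (l + 1 : ℕ) := by
  rw [map_sum]
  refine Finset.sum_congr rfl fun l _ ↦ ?_
  rw [← map_pow]
  ext a b
  simp

theorem sum_smul_pow_mem_nilCommTuples {r : ℕ} {z : Matrix (Fin (m + 1)) (Fin (m + 1)) k}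
    (hz : IsNilpotent z) (c : Fin r → Fin m → k) :
    (fun i ↦ ∑ l : Fin m, c i l • z ^ (l + 1 : ℕ)) ∈ nilCommTuples k (m + 1) r := by
  refine ⟨fun i ↦ ?_, fun i j ↦ ?_⟩
  · refine Commute.isNilpotent_sum (fun l _ ↦ ?_) fun l l' _ _ ↦ ?_
    · exact (hz.pow_of_pos l.val.succ_ne_zero).smul _
    · exact (((Commute.refl z).pow_pow _ _).smul_left _).smul_right _
  · refine Commute.sum_left _ _ _ fun l _ ↦ Commute.sum_right _ _ _ fun l' _ ↦ ?_
    exact (((Commute.refl z).pow_pow _ _).smul_left _).smul_right _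

/-- A family of commuting nilpotent tuples, parametrized by polynomials in the entries of a
matrix `g` and in further coefficients, containing all tuples with regular first entry. -/
def paramTuple (w : (Fin (m + 1) × Fin (m + 1)) ⊕ (Fin (s + 1) × Fin m) → B) :
    Fin (s + 1) → Matrix (Fin (m + 1)) (Fin (m + 1)) B :=
  fun i ↦ ∑ l : Fin m, w (.inr (i, l)) •
    scaledConj (.of fun a b ↦ w (.inl (a, b))) ^ (l + 1 : ℕ)

theorem map_paramTuple (f : B →+* B')
    (w : (Fin (m + 1) × Fin (m + 1)) ⊕ (Fin (s + 1) × Fin m) → B) (i : Fin (s + 1)) :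
    f.mapMatrix (paramTuple w i) = paramTuple (f ∘ w) i := by
  rw [paramTuple, map_sum_smul_pow, map_scaledConj]
  rfl

theorem paramTuple_mem (w : (Fin (m + 1) × Fin (m + 1)) ⊕ (Fin (s + 1) × Fin m) → k) :
    paramTuple w ∈ nilCommTuples k (m + 1) (s + 1) :=
  sum_smul_pow_mem_nilCommTuples (isNilpotent_scaledConj _) fun i l ↦ w (.inr (i, l))

theorem exists_paramTuple_eq {x : Fin (s + 1) → Matrix (Fin (m + 1)) (Fin (m + 1)) k}
    (hx : x ∈ nilCommTuples k (m + 1) (s + 1)) (hreg : x 0 ^ m ≠ 0) :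
    ∃ w, paramTuple w = x := by
  obtain ⟨v, hv⟩ : ∃ v, (x 0 ^ m) *ᵥ v ≠ 0 := by
    by_contra! h
    exact hreg (Matrix.ext_of_mulVec_single fun i ↦ by rw [h, zero_mulVec])
  set g := krylov (x 0) v
  have hdet : g.det ≠ 0 := det_krylov_ne_zero (pow_card_eq_zero_of_isNilpotent (hx.1 0)) hv
  have hz : x 0 = g.det⁻¹ • scaledConj g := eq_conj_lowerShift (hx.1 0) hdet
  refine ⟨Sum.elim (fun p ↦ g p.1 p.2) fun p ↦
    (g.det⁻¹ * (g.adjugate *ᵥ (x p.1 *ᵥ v)) p.2.succ) * g.det⁻¹ ^ (p.2 + 1 : ℕ), ?_⟩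
  ext1 i
  conv_rhs => rw [eq_sum_adjugate_krylov (hx.2 0 i) (hx.1 0) (hx.1 i) hdet]
  refine Finset.sum_congr rfl fun l _ ↦ ?_
  rw [show x 0 ^ (l + 1 : ℕ) = g.det⁻¹ ^ (l + 1 : ℕ) • scaledConj g ^ (l + 1 : ℕ) by
    rw [hz, smul_pow], smul_smul]
  rfl

/-- Rational coordinates on the commuting nilpotent tuples whose first entry has the first
basis vector as a cyclic vector. -/
def tupleCoord (x : Fin (s + 1) → Matrix (Fin (m + 1)) (Fin (m + 1)) B) :
    (Fin (m + 1) × Fin m) ⊕ (Fin s × Fin m) → B :=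
  Sum.elim (fun p ↦ krylov (x 0) (Pi.single 0 1) p.1 p.2.succ) fun p ↦
    ((krylov (x 0) (Pi.single 0 1)).adjugate *ᵥ (x p.1.succ *ᵥ Pi.single 0 1)) p.2.succ

theorem krylov_single_eq (x : Fin (s + 1) → Matrix (Fin (m + 1)) (Fin (m + 1)) B) :
    krylov (x 0) (Pi.single 0 1) =
      .of fun a ↦ Fin.cons (Pi.single (M := fun _ ↦ B) 0 1 a)
        fun j ↦ tupleCoord x (.inl (a, j)) := by
  ext a j
  refine Fin.cases ?_ (fun j ↦ ?_) j
  · simp [krylov, Matrix.one_apply, Pi.single_apply]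
  · simp [tupleCoord]

theorem comp_single_one (f : B →+* B') :
    f ∘ Pi.single (M := fun _ ↦ B) (0 : Fin (m + 1)) 1 = Pi.single 0 1 := by
  ext a
  simp [Pi.single_apply, apply_ite f]

theorem map_tupleCoord (f : B →+* B') (x : Fin (s + 1) → Matrix (Fin (m + 1)) (Fin (m + 1)) B) :
    f ∘ tupleCoord x = tupleCoord fun i ↦ f.mapMatrix (x i) := by
  ext (⟨a, j⟩ | ⟨i, l⟩)
  · simp only [tupleCoord, Function.comp_apply, Sum.elim_inl]
    rw [← comp_single_one f, ← map_krylov]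
    rfl
  · simp only [tupleCoord, Function.comp_apply, Sum.elim_inr]
    rw [← comp_single_one f, ← map_krylov, ← RingHom.map_adjugate, RingHom.map_mulVec]
    congr 2
    ext a
    rw [Function.comp_apply, RingHom.map_mulVec]
    rfl

theorem exists_tupleCoord_eq (t : (Fin (m + 1) × Fin m) ⊕ (Fin s × Fin m) → k)
    (hdet : (Matrix.of fun a ↦ Fin.cons (Pi.single (M := fun _ ↦ k) 0 1 a)
      fun j ↦ t (.inl (a, j)) : Matrix (Fin (m + 1)) (Fin (m + 1)) k).det ≠ 0) :
    ∃ x ∈ nilCommTuples k (m + 1) (s + 1), tupleCoord x = t := by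
  set g : Matrix (Fin (m + 1)) (Fin (m + 1)) k := .of fun a ↦
    Fin.cons (Pi.single (M := fun _ ↦ k) 0 1 a) fun j ↦ t (.inl (a, j)) with hg
  set z := g * lowerShift k m * g⁻¹ with hz
  have hzn : IsNilpotent z := by
    rw [hz, Matrix.inv_def, mul_smul_comm]
    exact (isNilpotent_scaledConj g).smul _
  set y : Fin s → Matrix (Fin (m + 1)) (Fin (m + 1)) k :=
    fun i ↦ ∑ l : Fin m, (g.det⁻¹ * t (.inr (i, l))) • z ^ (l + 1 : ℕ) with hy
  have hym : y ∈ nilCommTuples k (m + 1) s := sum_smul_pow_mem_nilCommTuples hzn _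
  have hzy (i : Fin s) : Commute z (y i) :=
    .sum_right _ _ _ fun l _ ↦ ((Commute.refl z).pow_right _).smul_right _
  have hge : g *ᵥ Pi.single 0 1 = Pi.single 0 1 := by
    ext a
    simp [hg]
  have hk : krylov z (Pi.single 0 1) = g := by
    conv_lhs => rw [← hge]
    exact krylov_lowerShift g hdet.isUnit
  refine ⟨Fin.cons z y, ⟨Fin.cases hzn hym.1, Fin.cases (Fin.cases rfl hzy) fun i ↦
    Fin.cases (hzy i).symm.eq (hym.2 i)⟩, ?_⟩
  ext (⟨a, j⟩ | ⟨i, l⟩)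
  · simp [tupleCoord, hk, hg]
  · have hyi : y i *ᵥ Pi.single 0 1 =
        g *ᵥ Fin.cons 0 fun l ↦ g.det⁻¹ * t (.inr (i, l)) := by
      rw [← hk, krylov_mulVec, hk, Fin.sum_univ_succ]
      simp [hy]
    simp only [tupleCoord, Sum.elim_inr, Fin.cons_zero, Fin.cons_succ, hk, hyi]
    rw [mulVec_mulVec, adjugate_mul, smul_mulVec, one_mulVec]
    simp [hdet]

theorem exists_eq_map_of_tupleCoord_mem_range (f : k →+* K)
    {x : Fin (s + 1) → Matrix (Fin (m + 1)) (Fin (m + 1)) K}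
    (hx : x ∈ nilCommTuples K (m + 1) (s + 1))
    (hdet : (krylov (x 0) (Pi.single 0 1)).det ≠ 0) (h : ∀ p, tupleCoord x p ∈ f.range)
    (i : Fin (s + 1)) : ∃ y, f.mapMatrix y = x i := by
  choose t ht using h
  set g := krylov (x 0) (Pi.single 0 1) with hg
  obtain ⟨g', hg'⟩ : ∃ g', f.mapMatrix g' = g := by
    refine ⟨.of fun a ↦ Fin.cons (Pi.single (M := fun _ ↦ k) 0 1 a) fun j ↦ t (.inl (a, j)), ?_⟩
    rw [hg, krylov_single_eq]
    ext a j
    refine Fin.cases ?_ (fun j ↦ ?_) j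
    · simp [Pi.single_apply, apply_ite f]
    · simp [ht]
  have hdet' : f g'.det = g.det := by rw [RingHom.map_det, hg']
  have h0 : f.mapMatrix (g'.det⁻¹ • scaledConj g') = x 0 := by
    rw [eq_conj_lowerShift (hx.1 0) hdet, ← hg, ← hdet', ← map_inv₀, ← scaledConj, ← hg',
      ← map_scaledConj]
    ext a b
    simp
  refine Fin.cases ⟨_, h0⟩ (fun i ↦ ?_) i
  refine ⟨∑ l : Fin m, (g'.det⁻¹ * t (.inr (i, l))) • (g'.det⁻¹ • scaledConj g') ^ (l + 1 : ℕ), ?_⟩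
  rw [map_sum_smul_pow, h0,
    eq_sum_adjugate_krylov (hx.2 0 i.succ) (hx.1 0) (hx.1 i.succ) hdet]
  refine Finset.sum_congr rfl fun l _ ↦ ?_
  rw [map_mul, map_inv₀, hdet', ht]
  rfl

end Parametrization

section Zariski

open Topology

variable {k : Type*} [Field k] {n r m s : ℕ}

attribute [local instance] matTupleZariski

/-- The entries of a tuple of matrices, as a point of affine space. -/
def tupleEntries {B : Type*} (x : Fin r → Matrix (Fin n) (Fin n) B) (q : Fin r × Fin n × Fin n) :
    B :=
  x q.1 q.2.1 q.2.2

/-- The prime of the affine coordinate ring given by a tuple of matrices. -/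
noncomputable def tuplePoint (x : Fin r → Matrix (Fin n) (Fin n) k) :
    PrimeSpectrum (MvPolynomial (Fin r × Fin n × Fin n) k) :=
  pointToPoint (tupleEntries x)

/-- The ideal of polynomials vanishing on a set of tuples of matrices. -/
noncomputable def tupleIdeal (S : Set (Fin r → Matrix (Fin n) (Fin n) k)) :
    Ideal (MvPolynomial (Fin r × Fin n × Fin n) k) :=
  PrimeSpectrum.vanishingIdeal (tuplePoint '' S)

theorem mem_tupleIdeal {S : Set (Fin r → Matrix (Fin n) (Fin n) k)}
    {p : MvPolynomial (Fin r × Fin n × Fin n) k} :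
    p ∈ tupleIdeal S ↔ ∀ x ∈ S, eval (tupleEntries x) p = 0 := by
  have h : tuplePoint '' S = pointToPoint '' (tupleEntries '' S) :=
    Set.image_comp pointToPoint tupleEntries S
  rw [tupleIdeal, h, vanishingIdeal_pointToPoint, mem_vanishingIdeal_iff, Set.forall_mem_image]
  rfl

theorem isInducing_tuplePoint :
    IsInducing (tuplePoint : (Fin r → Matrix (Fin n) (Fin n) k) → _) := by
  refine ⟨?_⟩
  rw [PrimeSpectrum.isTopologicalBasis_basic_opens.eq_generateFrom, induced_generateFrom_eq]
  refine congrArg generateFrom (Set.ext fun U ↦ ?_)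
  have hp (p : MvPolynomial (Fin r × Fin n × Fin n) k) :
      tuplePoint ⁻¹' (PrimeSpectrum.basicOpen p : Set (PrimeSpectrum _)) =
        {x | eval (tupleEntries x) p ≠ 0} := by
    ext x
    exact (mem_vanishingIdeal_singleton_iff _ _).not
  simp only [Set.mem_image, Set.exists_range_iff, hp]
  exact exists_congr fun p ↦ eq_comm

theorem closedPoints_subset_range_tuplePoint [IsAlgClosed k] :
    closedPoints (PrimeSpectrum (MvPolynomial (Fin r × Fin n × Fin n) k)) ⊆
      Set.range (tuplePoint : (Fin r → Matrix (Fin n) (Fin n) k) → _) := by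
  intro P hP
  obtain ⟨v, hv⟩ := eq_vanishingIdeal_singleton_of_isMaximal k
    ((PrimeSpectrum.isClosed_singleton_iff_isMaximal P).mp hP)
  exact ⟨fun i ↦ .of fun a b ↦ v (i, a, b), PrimeSpectrum.ext hv.symm⟩

theorem isOpen_setOf_eval_ne_zero (p : MvPolynomial (Fin r × Fin n × Fin n) k) :
    IsOpen {x : Fin r → Matrix (Fin n) (Fin n) k | eval (tupleEntries x) p ≠ 0} :=
  isOpen_generateFrom_of_mem ⟨p, rfl⟩

/-- The tuple of matrices with indeterminate entries. -/
noncomputable def genericTuple (k : Type*) [Field k] (n r : ℕ) (i : Fin r) :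
    Matrix (Fin n) (Fin n) (MvPolynomial (Fin r × Fin n × Fin n) k) :=
  .of fun a b ↦ X (i, a, b)

theorem eval_mapMatrix_genericTuple (x : Fin r → Matrix (Fin n) (Fin n) k) (i : Fin r) :
    (eval (tupleEntries x)).mapMatrix (genericTuple k n r i) = x i := by
  ext a b
  simp [genericTuple, tupleEntries]

theorem map_genericTuple_mem_nilCommTuples {K : Type*} [Field K]
    {f : MvPolynomial (Fin r × Fin (m + 1) × Fin (m + 1)) k →+* K}
    (hf : ∀ p ∈ tupleIdeal (nilCommTuples k (m + 1) r), f p = 0) :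
    (fun i ↦ f.mapMatrix (genericTuple k (m + 1) r i)) ∈ nilCommTuples K (m + 1) r := by
  have key (M : Matrix (Fin (m + 1)) (Fin (m + 1)) _)
      (hM : ∀ x ∈ nilCommTuples k (m + 1) r, (eval (tupleEntries x)).mapMatrix M = 0) :
      f.mapMatrix M = 0 := by
    ext a b
    exact hf _ (mem_tupleIdeal.mpr fun x hx ↦ congrFun (congrFun (hM x hx) a) b)
  refine ⟨fun i ↦ ⟨m + 1, ?_⟩, fun i j ↦ ?_⟩
  · rw [← map_pow]
    refine key _ fun x hx ↦ ?_
    rw [map_pow, eval_mapMatrix_genericTuple, pow_card_eq_zero_of_isNilpotent (hx.1 i)]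
  · rw [← sub_eq_zero, ← map_mul, ← map_mul, ← map_sub]
    refine key _ fun x hx ↦ ?_
    rw [map_sub, map_mul, map_mul, eval_mapMatrix_genericTuple, eval_mapMatrix_genericTuple,
      hx.2 i j, sub_self]

theorem isClosed_nilCommTuples : IsClosed (nilCommTuples k (m + 1) r) := by
  have h : nilCommTuples k (m + 1) r =
      ⋂ p ∈ tupleIdeal (nilCommTuples k (m + 1) r), {x | eval (tupleEntries x) p ≠ 0}ᶜ := by
    refine subset_antisymm (fun x hx ↦ Set.mem_iInter₂.mpr fun p hp ↦ ?_) fun x hx ↦ ?_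
    · exact not_not.mpr (mem_tupleIdeal.mp hp x hx)
    · have := map_genericTuple_mem_nilCommTuples (f := eval (tupleEntries x))
        fun p hp ↦ not_not.mp (Set.mem_iInter₂.mp hx p hp)
      simpa only [eval_mapMatrix_genericTuple] using this
  rw [h]
  exact isClosed_biInter fun p _ ↦ (isOpen_setOf_eval_ne_zero p).isClosed_compl

theorem lowerShift_pow_ne_zero (B : Type*) [CommRing B] [Nontrivial B] (m : ℕ) :
    lowerShift B m ^ m ≠ 0 := by
  intro h
  simpa [lowerShift_pow_apply] using congrFun (congrFun h (Fin.last m)) 0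

theorem cons_lowerShift_mem_nilCommTuples :
    (Fin.cons (lowerShift k m) 0 : Fin (s + 1) → Matrix (Fin (m + 1)) (Fin (m + 1)) k) ∈
      nilCommTuples k (m + 1) (s + 1) :=
  ⟨Fin.cases ⟨m + 1, lowerShift_pow_eq_zero⟩ fun _ ↦ IsNilpotent.zero,
    Fin.cases (Fin.cases rfl fun _ ↦ by simp) fun _ ↦ Fin.cases (by simp) fun _ ↦ by simp⟩

theorem isOpen_setOf_pow_ne_zero :
    IsOpen {x : Fin (s + 1) → Matrix (Fin (m + 1)) (Fin (m + 1)) k | x 0 ^ m ≠ 0} := by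
  have h : {x : Fin (s + 1) → Matrix (Fin (m + 1)) (Fin (m + 1)) k | x 0 ^ m ≠ 0} =
      ⋃ a, ⋃ b, {x | eval (tupleEntries x) ((genericTuple k (m + 1) (s + 1) 0 ^ m) a b) ≠ 0} := by
    ext x
    have hx (a b : Fin (m + 1)) :
        eval (tupleEntries x) ((genericTuple k (m + 1) (s + 1) 0 ^ m) a b) = (x 0 ^ m) a b := by
      rw [← eval_mapMatrix_genericTuple x 0, ← map_pow]
      rfl
    simp only [Set.mem_ofPred_eq, Set.mem_iUnion, hx, ne_eq, ← Matrix.ext_iff, not_forall,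
      Matrix.zero_apply]
  rw [h]
  exact isOpen_iUnion fun a ↦ isOpen_iUnion fun b ↦ isOpen_setOf_eval_ne_zero _

theorem isIrreducible_regular_nilCommTuples [Infinite k] :
    IsIrreducible {x | x ∈ nilCommTuples k (m + 1) (s + 1) ∧ x 0 ^ m ≠ 0} := by
  refine isInducing_tuplePoint.isIrreducible_of_image
    (PrimeSpectrum.isIrreducible_iff_vanishingIdeal_isPrime.mpr ?_)
  let ρ := (Fin (m + 1) × Fin (m + 1)) ⊕ (Fin (s + 1) × Fin m)
  let W := MvPolynomial ρ k
  let P : Fin (s + 1) → Matrix (Fin (m + 1)) (Fin (m + 1)) W := paramTuple X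
  let φ : MvPolynomial (Fin (s + 1) × Fin (m + 1) × Fin (m + 1)) k →ₐ[k] W :=
    aeval (tupleEntries P)
  have hparam (w : ρ → k) (i : Fin (s + 1)) :
      (eval w).mapMatrix (P i) = paramTuple w i := by
    rw [map_paramTuple]
    congr 1
    ext
    simp
  have hφ (w : ρ → k) (p) : eval w (φ p) = eval (tupleEntries (paramTuple w)) p := by
    have : (eval w).comp φ.toRingHom = eval (tupleEntries (paramTuple w)) := by
      refine MvPolynomial.ringHom_ext (fun c ↦ by simp [φ, W, algebraMap_eq]) fun q ↦ ?_
      simpa [φ, tupleEntries] using congrFun (congrFun (hparam w q.1) q.2.1) q.2.2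
    exact RingHom.congr_fun this p
  suffices h : tupleIdeal {x | x ∈ nilCommTuples k (m + 1) (s + 1) ∧ x 0 ^ m ≠ 0} =
      RingHom.ker φ by
    rw [tupleIdeal] at h
    rw [h]
    exact RingHom.ker_isPrime φ
  ext p
  rw [mem_tupleIdeal, RingHom.mem_ker]
  refine ⟨fun hp ↦ ?_, fun hp x hx ↦ ?_⟩
  · obtain ⟨w₀, hw₀⟩ := exists_paramTuple_eq (k := k) (m := m) (s := s)
      cons_lowerShift_mem_nilCommTuples
      (lowerShift_pow_ne_zero k m)
    have hreg (w : ρ → k) (a b : Fin (m + 1)) :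
        eval w ((P 0 ^ m) a b) =
          (paramTuple w (0 : Fin (s + 1)) ^ m) a b := by
      rw [← hparam, ← map_pow]
      rfl
    have hq : (P 0 ^ m) (Fin.last m) 0 ≠ 0 := by
      intro h
      have h2 := hreg w₀ (Fin.last m) 0
      rw [h, hw₀, map_zero, Fin.cons_zero, lowerShift_pow_apply] at h2
      simp at h2
    refine (mul_eq_zero.mp (MvPolynomial.funext fun w ↦ ?_)).resolve_right hq
    rw [map_mul, map_zero, hφ, hreg]
    by_cases hw : paramTuple w (0 : Fin (s + 1)) ^ m = 0
    · rw [hw, Matrix.zero_apply, mul_zero]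
    · rw [hp _ ⟨paramTuple_mem w, hw⟩, zero_mul]
  · obtain ⟨w, rfl⟩ := exists_paramTuple_eq hx.1 hx.2
    rw [← hφ, hp, map_zero]

theorem isIrreducible_nilCommTuples_iff [Infinite k] :
    IsIrreducible (nilCommTuples k (m + 1) (s + 1)) ↔ nilCommTuples k (m + 1) (s + 1) =
      closure {x | x ∈ nilCommTuples k (m + 1) (s + 1) ∧ x 0 ^ m ≠ 0} := by
  refine ⟨fun h ↦ subset_antisymm ?_ ?_, fun h ↦ ?_⟩
  · exact subset_closure_inter_of_isPreirreducible_of_isOpen h.isPreirreducible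
      isOpen_setOf_pow_ne_zero
      ⟨_, cons_lowerShift_mem_nilCommTuples, lowerShift_pow_ne_zero k m⟩
  · exact isClosed_nilCommTuples.closure_subset_iff.mpr fun x hx ↦ hx.1
  · rw [h]
    exact isIrreducible_regular_nilCommTuples.closure

theorem algebraicIndependent_tupleCoord [Infinite k] :
    AlgebraicIndependent k fun t ↦ Ideal.Quotient.mk (tupleIdeal (nilCommTuples k (m + 1) (s + 1)))
      (tupleCoord (genericTuple k (m + 1) (s + 1)) t) := by
  set I := tupleIdeal (nilCommTuples k (m + 1) (s + 1))
  let τ := (Fin (m + 1) × Fin m) ⊕ (Fin s × Fin m)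
  rw [algebraicIndependent_iff]
  intro p hp
  let g : Matrix (Fin (m + 1)) (Fin (m + 1)) (MvPolynomial τ k) :=
    .of fun a ↦ Fin.cons (Pi.single (M := fun _ ↦ MvPolynomial τ k) 0 1 a)
      fun j ↦ X (.inl (a, j))
  have hg (t : τ → k) : (eval t).mapMatrix g = .of fun a ↦
      Fin.cons (Pi.single (M := fun _ ↦ k) 0 1 a) fun j ↦ t (.inl (a, j)) := by
    ext a j
    refine Fin.cases ?_ (fun j ↦ ?_) j
    · simp [g, Pi.single_apply, apply_ite (eval t)]
    · simp [g]
  have hdet : g.det ≠ 0 := by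
    intro h0
    have h1 := congrArg (eval (Sum.elim (fun p ↦ if p.1 = p.2.succ then 1 else 0) 0 : τ → k)) h0
    rw [RingHom.map_det, hg, map_zero] at h1
    refine one_ne_zero (α := k) ?_
    rw [← h1, ← Matrix.det_one (n := Fin (m + 1))]
    congr 1
    ext a j
    refine Fin.cases ?_ (fun j ↦ ?_) j
    · simp [Matrix.one_apply, Pi.single_apply]
    · simp [Matrix.one_apply]
  have hmem : aeval (tupleCoord (genericTuple k (m + 1) (s + 1))) p ∈ I := by
    rw [← Ideal.Quotient.eq_zero_iff_mem, ← hp]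
    exact comp_aeval_apply _ (Ideal.Quotient.mkₐ k I) p
  refine (mul_eq_zero.mp (MvPolynomial.funext fun t ↦ ?_ : p * g.det = 0)).resolve_right hdet
  rw [map_mul, map_zero, RingHom.map_det, hg]
  by_cases ht : (Matrix.of fun a ↦ Fin.cons (Pi.single (M := fun _ ↦ k) 0 1 a)
    fun j ↦ t (.inl (a, j)) : Matrix (Fin (m + 1)) (Fin (m + 1)) k).det = 0
  · rw [ht, mul_zero]
  · obtain ⟨x, hx, rfl⟩ := exists_tupleCoord_eq t ht
    have h0 : aeval (tupleEntries x) (aeval (tupleCoord (genericTuple k (m + 1) (s + 1))) p) = 0 :=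
      mem_tupleIdeal.mp hmem x hx
    have hx' := map_tupleCoord (eval (tupleEntries x)) (genericTuple k (m + 1) (s + 1))
    simp only [eval_mapMatrix_genericTuple] at hx'
    rw [comp_aeval_apply] at h0
    rw [← hx']
    exact mul_eq_zero_of_left h0 _

open scoped IntermediateField.algebraAdjoinAdjoin in
theorem isTranscendenceBasis_tupleCoord [Infinite k]
    (h : (tupleIdeal (nilCommTuples k (m + 1) (s + 1))).IsPrime) :
    IsTranscendenceBasis k fun t ↦ Ideal.Quotient.mk (tupleIdeal (nilCommTuples k (m + 1) (s + 1)))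
      (tupleCoord (genericTuple k (m + 1) (s + 1)) t) := by
  set I := tupleIdeal (nilCommTuples k (m + 1) (s + 1))
  let A := MvPolynomial (Fin (s + 1) × Fin (m + 1) × Fin (m + 1)) k ⧸ I
  have : IsDomain A := Ideal.Quotient.isDomain I
  let τ := (Fin (m + 1) × Fin m) ⊕ (Fin s × Fin m)
  set y : τ → A := fun t ↦ Ideal.Quotient.mk I (tupleCoord (genericTuple k (m + 1) (s + 1)) t)
  let K := FractionRing A
  let π : MvPolynomial (Fin (s + 1) × Fin (m + 1) × Fin (m + 1)) k →+* K :=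
    (algebraMap A K).comp (Ideal.Quotient.mk I)
  have hπ (p) : π p = 0 ↔ p ∈ I := by
    rw [← Ideal.Quotient.eq_zero_iff_mem]
    exact map_eq_zero_iff _ (IsFractionRing.injective A K)
  set x : Fin (s + 1) → Matrix (Fin (m + 1)) (Fin (m + 1)) K :=
    fun i ↦ π.mapMatrix (genericTuple k (m + 1) (s + 1) i) with hx
  have hxmem : x ∈ nilCommTuples K (m + 1) (s + 1) :=
    map_genericTuple_mem_nilCommTuples fun p hp ↦ (hπ p).mpr hp
  have hdet : (krylov (x 0) (Pi.single 0 1)).det ≠ 0 := by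
    have h1 : krylov (x 0) (Pi.single 0 1) =
        π.mapMatrix (krylov (genericTuple k (m + 1) (s + 1) 0) (Pi.single 0 1)) := by
      rw [map_krylov, comp_single_one]
    rw [h1, ← RingHom.map_det, ne_eq, hπ]
    intro h2
    have h3 := mem_tupleIdeal.mp h2 _ cons_lowerShift_mem_nilCommTuples
    rw [RingHom.map_det, map_krylov, eval_mapMatrix_genericTuple, comp_single_one,
      Fin.cons_zero] at h3
    have h4 := krylov_lowerShift (1 : Matrix (Fin (m + 1)) (Fin (m + 1)) k) (by simp)
    simp only [one_mul, inv_one, mul_one, one_mulVec] at h4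
    rw [h4, det_one] at h3
    exact one_ne_zero h3
  let S : Set K := Set.range (algebraMap A K ∘ y)
  let F := IntermediateField.adjoin k S
  have hcoord (t : τ) : tupleCoord x t ∈ (algebraMap F K).range := by
    have ht : tupleCoord x t = algebraMap A K (y t) := by
      rw [hx, ← map_tupleCoord]
      rfl
    rw [ht]
    exact ⟨⟨_, IntermediateField.subset_adjoin k S ⟨t, rfl⟩⟩, rfl⟩
  have hF : F = ⊤ := by
    have hA (a : A) : algebraMap A K a ∈ F := by
      obtain ⟨p, rfl⟩ := Ideal.Quotient.mk_surjective a
      induction p using MvPolynomial.induction_on with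
      | C c => exact F.algebraMap_mem c
      | add p q hp hq =>
        rw [map_add, map_add]
        exact add_mem hp hq
      | mul_X p q hp =>
        rw [map_mul, map_mul]
        refine mul_mem hp ?_
        obtain ⟨M, hM⟩ :=
          exists_eq_map_of_tupleCoord_mem_range (algebraMap F K) hxmem hdet hcoord q.1
        have : algebraMap F K (M q.2.1 q.2.2) = x q.1 q.2.1 q.2.2 := by
          rw [← hM]
          rfl
        change x q.1 q.2.1 q.2.2 ∈ F
        exact this ▸ (M q.2.1 q.2.2).2
    refine eq_top_iff.mpr fun z _ ↦ ?_
    obtain ⟨a, b, -, rfl⟩ := IsFractionRing.div_surjective (A := A) z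
    exact div_mem (hA a) (hA b)
  have hindK : AlgebraicIndependent k (algebraMap A K ∘ y) :=
    algebraicIndependent_tupleCoord.map' (f := IsScalarTower.toAlgHom k A K)
      (IsFractionRing.injective A K)
  have halg : Algebra.IsAlgebraic (Algebra.adjoin k S) K := by
    refine ⟨fun z ↦ ?_⟩
    obtain ⟨z, rfl⟩ : ∃ z' : F, algebraMap F K z' = z := ⟨⟨z, hF ▸ IntermediateField.mem_top⟩, rfl⟩
    exact (Algebra.IsAlgebraic.isAlgebraic (R := Algebra.adjoin k S) z).algebraMap
  exact .of_comp_algebraMap (hindK.isTranscendenceBasis_iff_isAlgebraic.mpr halg)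

theorem topologicalKrullDim_nilCommTuples [IsAlgClosed k]
    (h : IsIrreducible (nilCommTuples k (m + 1) (s + 1))) :
    topologicalKrullDim (nilCommTuples k (m + 1) (s + 1)) = ((m + 1) * m + s * m : ℕ) := by
  have hprime : (tupleIdeal (nilCommTuples k (m + 1) (s + 1))).IsPrime :=
    PrimeSpectrum.isIrreducible_iff_vanishingIdeal_isPrime.mp
      (h.image _ isInducing_tuplePoint.continuous.continuousOn)
  have : IsDomain (_ ⧸ tupleIdeal (nilCommTuples k (m + 1) (s + 1))) := Ideal.Quotient.isDomain _
  rw [isInducing_tuplePoint.topologicalKrullDim_eq_ringKrullDim_quotient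
    closedPoints_subset_range_tuplePoint isClosed_nilCommTuples]
  refine (ringKrullDim_eq_of_isTranscendenceBasis (isTranscendenceBasis_tupleCoord hprime)).trans ?_
  simp

end Zariski

/-- For all integers `n, r ≥ 2`, `C_r(N_n)` is irreducible iff `C_r(N_n) = N_n^r`; in
particular, if `C_r(N_n)` is irreducible then `dim C_r(N_n) = n² - n + (r-1)(n-1)`. -/
theorem nilCommTuples_irreducible_iff (k : Type*) [Field k] [IsAlgClosed k]
    (n r : ℕ) (hn : 2 ≤ n) (hr : 2 ≤ r) :
    letI := matTupleZariski k n r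
    (IsIrreducible (nilCommTuples k n r) ↔ nilCommTuples k n r = Nnr k n r) ∧
      (IsIrreducible (nilCommTuples k n r) →
        topologicalKrullDim (nilCommTuples k n r) = (n ^ 2 - n + (r - 1) * (n - 1) : ℕ)) := by
  obtain ⟨m, rfl⟩ := Nat.exists_eq_succ_of_ne_zero (by omega : n ≠ 0)
  obtain ⟨s, rfl⟩ := Nat.exists_eq_succ_of_ne_zero (by omega : r ≠ 0)
  have hreg : {x : Fin (s + 1) → Matrix (Fin (m + 1)) (Fin (m + 1)) k |
      x ∈ nilCommTuples k (m + 1) (s + 1) ∧ ∀ i : Fin (s + 1), (i : ℕ) = 0 → x i ^ m ≠ 0} =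
      {x | x ∈ nilCommTuples k (m + 1) (s + 1) ∧ x 0 ^ m ≠ 0} := by
    ext x
    refine and_congr_right fun _ ↦ ⟨fun h ↦ h 0 rfl, fun h i hi ↦ ?_⟩
    obtain rfl : i = 0 := Fin.ext hi
    exact h
  refine ⟨isIrreducible_nilCommTuples_iff.trans ?_, fun h ↦ ?_⟩
  · rw [← hreg]
    rfl
  · refine (topologicalKrullDim_nilCommTuples h).trans ?_
    have hsq : (m + 1) ^ 2 - (m + 1) = (m + 1) * m := by
      rw [Nat.sub_eq_iff_eq_add (Nat.le_self_pow two_ne_zero _)]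
      ring
    rw [← hsq]
    rfl
end

section
/- Let n, r ≥ 2 be integers and suppose that C_r(Mat_m(k)) is irreducible in the Zariski topology for every integer 1 ≤ m < n. Then C_r(Mat_n(k)) = G_n^r ∪ (C_r(N_n) + (k I_n)^r), where C_r(N_n) + (k I_n)^r = {(x_1 + λ_1 I_n, …, x_r + λ_r I_n) : (x_1,…,x_r) ∈ C_r(N_n), λ_1,…,λ_r ∈ k}. -/
open MvPolynomial Matrix TopologicalSpace

/-- `C_r(Mat_n(k))`: the set of commuting `r`-tuples of `n × n` matrices. -/
def commTuples (k : Type*) [Field k] (n r : ℕ) :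
    Set (Fin r → Matrix (Fin n) (Fin n) k) :=
  {x | ∀ i j, x i * x j = x j * x i}

/-- `G_n^r`: the Zariski closure of the set of commuting `r`-tuples whose first entry is
nonderogatory (its minimal polynomial has degree `n`). -/
noncomputable def Gnr (k : Type*) [Field k] (n r : ℕ) :
    Set (Fin r → Matrix (Fin n) (Fin n) k) :=
  letI := matTupleZariski k n r
  closure {x | x ∈ commTuples k n r ∧
    ∀ i : Fin r, (i : ℕ) = 0 → (minpoly k (x i)).natDegree = n}

section ZariskiTopology

attribute [local instance] matTupleZariski

/-- The algebra of functions on `r`-tuples of `n × n` matrices that are polynomial in the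
matrix entries. -/
noncomputable def polyFun (k : Type*) [CommRing k] (n r : ℕ) :
    Subalgebra k ((Fin r → Matrix (Fin n) (Fin n) k) → k) :=
  (MvPolynomial.aeval (R := k) fun (q : Fin r × Fin n × Fin n)
    (x : Fin r → Matrix (Fin n) (Fin n) k) => x q.1 q.2.1 q.2.2).range

theorem mem_polyFun_iff {k : Type*} [CommRing k] {n r : ℕ}
    {g : (Fin r → Matrix (Fin n) (Fin n) k) → k} :
    g ∈ polyFun k n r ↔ ∃ p : MvPolynomial (Fin r × Fin n × Fin n) k,
      ∀ x, MvPolynomial.eval (fun q => x q.1 q.2.1 q.2.2) p = g x := by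
  have key : ∀ (p : MvPolynomial (Fin r × Fin n × Fin n) k)
      (x : Fin r → Matrix (Fin n) (Fin n) k),
      MvPolynomial.aeval (R := k) (fun (q : Fin r × Fin n × Fin n)
        (x : Fin r → Matrix (Fin n) (Fin n) k) => x q.1 q.2.1 q.2.2) p x =
      MvPolynomial.eval (fun q => x q.1 q.2.1 q.2.2) p := by
    intro p x
    induction p using MvPolynomial.induction_on with
    | C a => simp [Pi.algebraMap_apply]
    | add p q hp hq => simp [hp, hq]
    | mul_X p i hp => simp [hp]
  constructor
  · rintro ⟨p, rfl⟩
    exact ⟨p, fun x => (key p x).symm⟩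
  · rintro ⟨p, hp⟩
    exact ⟨p, funext fun x => (key p x).trans (hp x)⟩

theorem entry_mem_polyFun {k : Type*} [CommRing k] {n r : ℕ} (i : Fin r) (a b : Fin n) :
    (fun x : Fin r → Matrix (Fin n) (Fin n) k => x i a b) ∈ polyFun k n r :=
  mem_polyFun_iff.2 ⟨MvPolynomial.X (i, a, b), fun x => by simp⟩

theorem const_mem_polyFun {k : Type*} [CommRing k] {n r : ℕ} (c : k) :
    (fun _ : Fin r → Matrix (Fin n) (Fin n) k => c) ∈ polyFun k n r :=
  mem_polyFun_iff.2 ⟨MvPolynomial.C c, fun x => by simp⟩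

theorem sum_mem_polyFun {k ι : Type*} [CommRing k] {n r : ℕ} (s : Finset ι)
    {g : ι → (Fin r → Matrix (Fin n) (Fin n) k) → k} (hg : ∀ i ∈ s, g i ∈ polyFun k n r) :
    (fun x => ∑ i ∈ s, g i x) ∈ polyFun k n r := by
  have := (polyFun k n r).sum_mem hg
  rwa [Finset.sum_fn] at this

theorem prod_mem_polyFun {k ι : Type*} [CommRing k] {n r : ℕ} (s : Finset ι)
    {g : ι → (Fin r → Matrix (Fin n) (Fin n) k) → k} (hg : ∀ i ∈ s, g i ∈ polyFun k n r) :
    (fun x => ∏ i ∈ s, g i x) ∈ polyFun k n r := by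
  have := (polyFun k n r).prod_mem hg
  rwa [Finset.prod_fn] at this

theorem mul_entry_mem_polyFun {k : Type*} [CommRing k] {n r : ℕ}
    {F G : (Fin r → Matrix (Fin n) (Fin n) k) → Matrix (Fin n) (Fin n) k}
    (hF : ∀ a b, (fun x => F x a b) ∈ polyFun k n r)
    (hG : ∀ a b, (fun x => G x a b) ∈ polyFun k n r) (a b : Fin n) :
    (fun x => (F x * G x) a b) ∈ polyFun k n r := by
  simp only [Matrix.mul_apply]
  exact sum_mem_polyFun _ fun c _ => (polyFun k n r).mul_mem (hF a c) (hG c b)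

theorem pow_entry_mem_polyFun {k : Type*} [CommRing k] {n r : ℕ} (i : Fin r) (d : ℕ)
    (a b : Fin n) :
    (fun x : Fin r → Matrix (Fin n) (Fin n) k => (x i ^ d) a b) ∈ polyFun k n r := by
  induction d generalizing a b with
  | zero => simpa using const_mem_polyFun _
  | succ d ih =>
    simp only [pow_succ]
    exact mul_entry_mem_polyFun ih (entry_mem_polyFun i) a b

theorem linearMap_comp_mem_polyFun {k : Type*} [CommRing k] {n r : ℕ}
    {F : (Fin r → Matrix (Fin n) (Fin n) k) → Matrix (Fin n) (Fin n) k}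
    (hF : ∀ a b, (fun x => F x a b) ∈ polyFun k n r)
    (L : Matrix (Fin n) (Fin n) k →ₗ[k] k) :
    (fun x => L (F x)) ∈ polyFun k n r := by
  have h : ∀ x, L (F x) = ∑ a, ∑ b, F x a b * L (Matrix.single a b 1) := by
    intro x
    conv_lhs => rw [Matrix.matrix_eq_sum_single (F x)]
    simp only [map_sum]
    refine Finset.sum_congr rfl fun a _ => Finset.sum_congr rfl fun b _ => ?_
    rw [← smul_eq_mul, ← map_smul, Matrix.smul_single, smul_eq_mul, mul_one]
  simp only [h]
  exact sum_mem_polyFun _ fun a _ => sum_mem_polyFun _ fun b _ =>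
    (polyFun k n r).mul_mem (hF a b) (const_mem_polyFun _)

theorem det_mem_polyFun {k ι : Type*} [CommRing k] [Fintype ι] [DecidableEq ι] {n r : ℕ}
    {F : (Fin r → Matrix (Fin n) (Fin n) k) → Matrix ι ι k}
    (hF : ∀ a b, (fun x => F x a b) ∈ polyFun k n r) :
    (fun x => (F x).det) ∈ polyFun k n r := by
  simp only [Matrix.det_apply']
  exact sum_mem_polyFun _ fun s _ => (polyFun k n r).mul_mem (const_mem_polyFun _)
    (prod_mem_polyFun _ fun i _ => hF _ _)

theorem isOpen_ne_zero_of_mem_polyFun {k : Type*} [CommRing k] {n r : ℕ}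
    {g : (Fin r → Matrix (Fin n) (Fin n) k) → k} (hg : g ∈ polyFun k n r) :
    IsOpen {x | g x ≠ 0} := by
  obtain ⟨p, hp⟩ := mem_polyFun_iff.1 hg
  refine isOpen_generateFrom_of_mem ⟨p, ?_⟩
  simp only [hp]

theorem continuous_of_forall_mem_polyFun {k : Type*} [CommRing k] {m n r s : ℕ}
    {F : (Fin r → Matrix (Fin m) (Fin m) k) → Fin s → Matrix (Fin n) (Fin n) k}
    (hF : ∀ i a b, (fun x => F x i a b) ∈ polyFun k m r) : Continuous F := by
  choose P hP using fun i a b => mem_polyFun_iff.1 (hF i a b)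
  refine continuous_generateFrom_iff.2 ?_
  rintro _ ⟨p, rfl⟩
  have hp : (fun x => MvPolynomial.eval (fun q => F x q.1 q.2.1 q.2.2) p) ∈ polyFun k m r := by
    refine mem_polyFun_iff.2 ⟨MvPolynomial.bind₁ (fun q => P q.1 q.2.1 q.2.2) p, fun x => ?_⟩
    induction p using MvPolynomial.induction_on with
    | C a => simp
    | add p q hp hq => simp only [map_add, hp, hq]
    | mul_X p q hp => simp only [map_mul, hp, MvPolynomial.bind₁_X_right, hP, MvPolynomial.eval_X]
  exact isOpen_ne_zero_of_mem_polyFun hp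

theorem isClosed_commTuples (k : Type*) [Field k] (n r : ℕ) : IsClosed (commTuples k n r) := by
  have h : commTuples k n r =
      ⋂ (i) (j) (a) (b), {x | (x i * x j) a b - (x j * x i) a b ≠ 0}ᶜ := by
    ext x
    simp [commTuples, ← Matrix.ext_iff, sub_eq_zero]
  rw [h]
  refine isClosed_iInter fun i => isClosed_iInter fun j => isClosed_iInter fun a =>
    isClosed_iInter fun b => (isOpen_ne_zero_of_mem_polyFun ?_).isClosed_compl
  exact (polyFun k n r).sub_mem
    (mul_entry_mem_polyFun (entry_mem_polyFun i) (entry_mem_polyFun j) a b)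
    (mul_entry_mem_polyFun (entry_mem_polyFun j) (entry_mem_polyFun i) a b)

theorem Matrix.natDegree_minpoly_le {k : Type*} [Field k] {n : ℕ}
    (x : Matrix (Fin n) (Fin n) k) : (minpoly k x).natDegree ≤ n := by
  have := Polynomial.natDegree_le_of_dvd (Matrix.minpoly_dvd_charpoly x)
    (Matrix.charpoly_monic x).ne_zero
  simpa [Matrix.charpoly_natDegree_eq_dim] using this

theorem le_natDegree_minpoly_of_det_ne_zero {k A : Type*} [Field k] [Ring A] [Algebra k A]
    [FiniteDimensional k A] {n : ℕ} (T : A →ₗ[k] Fin n → k) {x : A}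
    (hx : (Matrix.of fun i j : Fin n => T (x ^ (i : ℕ)) j).det ≠ 0) :
    n ≤ (minpoly k x).natDegree := by
  by_contra! hlt
  have h0 := minpoly.aeval k x
  rw [Polynomial.aeval_eq_sum_range' hlt] at h0
  have hv : (fun i : Fin n => (minpoly k x).coeff i) = 0 := by
    refine Matrix.eq_zero_of_vecMul_eq_zero hx ?_
    funext j
    have := congrFun (congrArg T h0) j
    rw [Finset.sum_range] at this
    simpa [Matrix.vecMul, dotProduct] using this
  have := congrFun hv ⟨_, hlt⟩
  rw [Pi.zero_apply, Polynomial.coeff_natDegree,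
    (minpoly.monic (Algebra.IsIntegral.isIntegral x)).leadingCoeff] at this
  exact one_ne_zero this

theorem exists_linearMap_det_ne_zero {k A : Type*} [Field k] [Ring A] [Algebra k A]
    {n : ℕ} {x : A} (hx : (minpoly k x).natDegree = n) :
    ∃ T : A →ₗ[k] Fin n → k, (Matrix.of fun i j : Fin n => T (x ^ (i : ℕ)) j).det ≠ 0 := by
  subst hx
  have hli := linearIndependent_pow (K := k) x
  obtain ⟨T, hT⟩ := LinearMap.exists_leftInverse_of_injective
    (Fintype.linearCombination k fun i : Fin (minpoly k x).natDegree => x ^ (i : ℕ))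
    (LinearMap.ker_eq_bot.2 hli.fintypeLinearCombination_injective)
  refine ⟨T, ?_⟩
  have h1 : (Matrix.of fun i j : Fin (minpoly k x).natDegree => T (x ^ (i : ℕ)) j) = 1 := by
    ext i j
    have := congrFun (LinearMap.congr_fun hT (Pi.single i 1)) j
    simp only [LinearMap.comp_apply, Fintype.linearCombination_apply_single, one_smul] at this
    rw [Matrix.of_apply, this, Matrix.one_apply]
    simp [Pi.single_apply, eq_comm]
  simp [h1]

theorem isOpen_natDegree_minpoly_eq (k : Type*) [Field k] (n : ℕ) {r : ℕ} (i : Fin r) :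
    IsOpen {x : Fin r → Matrix (Fin n) (Fin n) k | (minpoly k (x i)).natDegree = n} := by
  refine isOpen_iff_forall_mem_open.2 fun x₀ hx₀ => ?_
  obtain ⟨T, hT⟩ := exists_linearMap_det_ne_zero hx₀
  refine ⟨{x | (Matrix.of fun a b : Fin n => T (x i ^ (a : ℕ)) b).det ≠ 0}, fun x hx => ?_,
    isOpen_ne_zero_of_mem_polyFun (det_mem_polyFun fun a b => ?_), hT⟩
  · exact (Matrix.natDegree_minpoly_le _).antisymm (le_natDegree_minpoly_of_det_ne_zero T hx)
  · exact linearMap_comp_mem_polyFun (pow_entry_mem_polyFun i a) (LinearMap.proj b ∘ₗ T)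

theorem exists_natDegree_minpoly_eq {k A : Type*} [Field k] [Infinite k] [Ring A] [Algebra k A]
    [FiniteDimensional k A] (m l : ℕ)
    (Ψ : Matrix (Fin m) (Fin m) k × Matrix (Fin l) (Fin l) k →ₐ[k] A)
    (hΨ : Function.Injective Ψ) :
    ∃ a b, m + l ≤ (minpoly k (Ψ (a, b))).natDegree := by
  let c : Fin m ⊕ Fin l ↪ k := finSumFinEquiv.toEmbedding.trans
    (Fin.valEmbedding.trans (Infinite.natEmbedding k))
  refine ⟨Matrix.diagonal (c ∘ Sum.inl), Matrix.diagonal (c ∘ Sum.inr), ?_⟩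
  rw [minpoly.algHom_eq Ψ hΨ]
  set D : Matrix (Fin m) (Fin m) k × Matrix (Fin l) (Fin l) k :=
    (Matrix.diagonal (c ∘ Sum.inl), Matrix.diagonal (c ∘ Sum.inr)) with hD
  by_contra! hlt
  have h0 := minpoly.aeval k D
  refine minpoly.ne_zero (Algebra.IsIntegral.isIntegral (R := k) D)
    (Polynomial.eq_zero_of_natDegree_lt_card_of_eval_eq_zero _ c.injective ?_ (by simpa using hlt))
  have hdiag : ∀ (s : ℕ) (d : Fin s → k) (f : Polynomial k),
      Polynomial.aeval (Matrix.diagonal d) f = Matrix.diagonal fun i => f.eval (d i) := by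
    intro s d f
    have h1 := Polynomial.aeval_algHom_apply (Matrix.diagonalAlgHom k : (Fin s → k) →ₐ[k] _) d f
    rw [Matrix.diagonalAlgHom_apply, Matrix.diagonalAlgHom_apply] at h1
    rw [h1]
    congr 1
    funext i
    rw [Polynomial.aeval_pi, AlgHom.pi_apply, Polynomial.coe_aeval_eq_eval]
  have h1 := Polynomial.aeval_algHom_apply
    (AlgHom.fst k (Matrix (Fin m) (Fin m) k) (Matrix (Fin l) (Fin l) k)) D (minpoly k D)
  have h2 := Polynomial.aeval_algHom_apply
    (AlgHom.snd k (Matrix (Fin m) (Fin m) k) (Matrix (Fin l) (Fin l) k)) D (minpoly k D)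
  rw [h0, map_zero] at h1 h2
  rintro (i | i)
  · simpa using congrFun (congrFun ((hdiag _ _ _).symm.trans h1) i) i
  · simpa using congrFun (congrFun ((hdiag _ _ _).symm.trans h2) i) i

theorem mem_Gnr_of_blocks {k : Type*} [Field k] [Infinite k] {m l n r : ℕ} (hr : 0 < r)
    (hml : m + l = n)
    (Ψ : Matrix (Fin m) (Fin m) k × Matrix (Fin l) (Fin l) k →ₐ[k] Matrix (Fin n) (Fin n) k)
    (hΨ : Function.Injective Ψ)
    (hm : IsIrreducible (commTuples k m r)) (hl : IsIrreducible (commTuples k l r))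
    {a : Fin r → Matrix (Fin m) (Fin m) k} {b : Fin r → Matrix (Fin l) (Fin l) k}
    (ha : a ∈ commTuples k m r) (hb : b ∈ commTuples k l r) :
    (fun i => Ψ (a i, b i)) ∈ Gnr k n r := by
  obtain ⟨a₀, b₀, hab₀⟩ := exists_natDegree_minpoly_eq m l Ψ hΨ
  have hcl : ∀ b : Fin r → Matrix (Fin l) (Fin l) k,
      Continuous fun (a : Fin r → Matrix (Fin m) (Fin m) k) i => Ψ (a i, b i) := by
    intro b
    refine continuous_of_forall_mem_polyFun fun i s t => ?_
    have h : ∀ x : Fin r → Matrix (Fin m) (Fin m) k, Ψ (x i, b i) s t =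
        (Matrix.entryLinearMap k k s t ∘ₗ Ψ.toLinearMap ∘ₗ LinearMap.inl k _ _) (x i) +
          Ψ (0, b i) s t := by
      intro x
      simp [← Matrix.add_apply, ← map_add]
    simp only [h]
    exact (polyFun k m r).add_mem (linearMap_comp_mem_polyFun (entry_mem_polyFun i) _)
      (const_mem_polyFun _)
  have hcr : ∀ a : Fin r → Matrix (Fin m) (Fin m) k,
      Continuous fun (b : Fin r → Matrix (Fin l) (Fin l) k) i => Ψ (a i, b i) := by
    intro a
    refine continuous_of_forall_mem_polyFun fun i s t => ?_
    have h : ∀ x : Fin r → Matrix (Fin l) (Fin l) k, Ψ (a i, x i) s t =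
        (Matrix.entryLinearMap k k s t ∘ₗ Ψ.toLinearMap ∘ₗ LinearMap.inr k _ _) (x i) +
          Ψ (a i, 0) s t := by
      intro x
      simp [← Matrix.add_apply, ← map_add]
    simp only [h]
    exact (polyFun k l r).add_mem (linearMap_comp_mem_polyFun (entry_mem_polyFun i) _)
      (const_mem_polyFun _)
  have hN := isOpen_natDegree_minpoly_eq k n (⟨0, hr⟩ : Fin r)
  have hΨ₀ : (fun _ : Fin r => Ψ (a₀, b₀)) ∈ {x : Fin r → Matrix (Fin n) (Fin n) k |
      (minpoly k (x ⟨0, hr⟩)).natDegree = n} :=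
    (Matrix.natDegree_minpoly_le _).antisymm (hml ▸ hab₀)
  refine mem_closure_iff.2 fun U hU haU => ?_
  obtain ⟨a', ha', ha'U, ha'N⟩ := hm.isPreirreducible _ _ (hU.preimage (hcl b))
    (hN.preimage (hcl fun _ => b₀)) ⟨a, ha, haU⟩ ⟨fun _ => a₀, fun _ _ => rfl, hΨ₀⟩
  obtain ⟨b', hb', hb'U, hb'N⟩ := hl.isPreirreducible _ _ (hU.preimage (hcr a'))
    (hN.preimage (hcr a')) ⟨b, hb, ha'U⟩ ⟨fun _ => b₀, fun _ _ => rfl, ha'N⟩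
  refine ⟨_, hb'U, fun i j => ?_, fun i hi => ?_⟩
  · simp only [← map_mul, Prod.mk_mul_mk, ha' i j, hb' i j]
  · obtain rfl : i = ⟨0, hr⟩ := Fin.ext hi
    exact hb'N

end ZariskiTopology

theorem exists_blockDiagonal_algHom {k : Type*} [Field k] {n : ℕ}
    {p q : Submodule k (Fin n → k)} (hpq : IsCompl p q) :
    ∃ Ψ : Matrix (Fin (Module.finrank k p)) (Fin (Module.finrank k p)) k ×
        Matrix (Fin (Module.finrank k q)) (Fin (Module.finrank k q)) k →ₐ[k]
        Matrix (Fin n) (Fin n) k,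
      Function.Injective Ψ ∧ ∀ X : Matrix (Fin n) (Fin n) k,
        (∀ v ∈ p, Matrix.toLin' X v ∈ p) → (∀ v ∈ q, Matrix.toLin' X v ∈ q) →
        ∃ A B, Ψ (A, B) = X := by
  let e₁ := (Module.finBasis k p).equivFun.symm
  let e₂ := (Module.finBasis k q).equivFun.symm
  let E := (e₁.prodCongr e₂).trans (Submodule.prodEquivOfIsCompl p q hpq)
  let Ψ := (LinearMap.toMatrixAlgEquiv' (R := k) (n := Fin n)).toAlgHom.comp
    ((E.conjAlgEquiv k).toAlgHom.comp ((LinearMap.prodMapAlgHom k _ _).comp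
      (AlgHom.prodMap (Matrix.toLinAlgEquiv' (R := k)).toAlgHom
        (Matrix.toLinAlgEquiv' (R := k)).toAlgHom)))
  have hΨ : ∀ A B, Matrix.toLin' (Ψ (A, B)) =
      E.conjAlgEquiv k ((Matrix.toLin' A).prodMap (Matrix.toLin' B)) :=
    fun A B => Matrix.toLin'_toMatrix'
      (E.conjAlgEquiv k ((Matrix.toLin' A).prodMap (Matrix.toLin' B)))
  refine ⟨Ψ, ?_, fun X hp hq => ?_⟩
  · rintro ⟨A, B⟩ ⟨A', B'⟩ h
    have h' := congrArg Matrix.toLin' h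
    rw [hΨ, hΨ] at h'
    have h'' := (E.conjAlgEquiv k).injective h'
    refine Prod.ext (Matrix.toLin'.injective (LinearMap.ext fun v => ?_))
      (Matrix.toLin'.injective (LinearMap.ext fun v => ?_))
    · simpa using congrArg Prod.fst (LinearMap.congr_fun h'' (v, 0))
    · simpa using congrArg Prod.snd (LinearMap.congr_fun h'' (0, v))
  · refine ⟨LinearMap.toMatrix' (e₁.symm.toLinearMap ∘ₗ
      (Matrix.toLin' X).restrict hp ∘ₗ e₁.toLinearMap), LinearMap.toMatrix'
      (e₂.symm.toLinearMap ∘ₗ (Matrix.toLin' X).restrict hq ∘ₗ e₂.toLinearMap),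
      Matrix.toLin'.injective (LinearMap.ext fun v => ?_)⟩
    obtain ⟨⟨u, w⟩, rfl⟩ := E.surjective v
    rw [hΨ, LinearEquiv.conjAlgEquiv_apply, Matrix.toLin'_toMatrix', Matrix.toLin'_toMatrix']
    simp [E, -Matrix.toLin'_apply]

/-- A commuting tuple of matrices over an algebraically closed field either consists of
matrices with a single eigenvalue each, or preserves a nontrivial direct sum decomposition. -/
theorem nilpotent_sub_or_exists_isCompl {k : Type*} [Field k] [IsAlgClosed k] {n r : ℕ}
    (hn : 0 < n) {x : Fin r → Matrix (Fin n) (Fin n) k} (hx : x ∈ commTuples k n r) :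
    (∀ i, ∃ c : k, IsNilpotent (x i - c • (1 : Matrix (Fin n) (Fin n) k))) ∨
    ∃ p q : Submodule k (Fin n → k), IsCompl p q ∧ p ≠ ⊥ ∧ q ≠ ⊥ ∧
      ∀ i, (∀ v ∈ p, Matrix.toLin' (x i) v ∈ p) ∧ ∀ v ∈ q, Matrix.toLin' (x i) v ∈ q := by
  refine or_iff_not_imp_left.2 fun hnil => ?_
  push Not at hnil
  obtain ⟨i, hi⟩ := hnil
  have : NeZero n := ⟨hn.ne'⟩
  obtain ⟨c, hc⟩ := Module.End.exists_eigenvalue (Matrix.toLin' (x i))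
  set y := x i - c • (1 : Matrix (Fin n) (Fin n) k) with hy
  obtain ⟨N, hN, hN1⟩ := ((LinearMap.eventually_isCompl_ker_pow_range_pow
    (Matrix.toLin' y)).and (Filter.eventually_ge_atTop 1)).exists
  have hcomm : ∀ j, Commute (Matrix.toLin' (x j)) (Matrix.toLin' y ^ N) := by
    intro j
    have h1 : Commute (x j) y :=
      Commute.sub_right (hx j i) ((Commute.one_right _).smul_right c)
    exact (h1.map (Matrix.toLinAlgEquiv' (R := k) (n := Fin n))).pow_right N
  refine ⟨_, _, hN, ?_, ?_, fun j => ⟨fun v hv => ?_, ?_⟩⟩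
  · obtain ⟨v, hv⟩ := hc.exists_hasEigenvector
    refine (Submodule.ne_bot_iff _).2 ⟨v, ?_, hv.2⟩
    obtain ⟨M, rfl⟩ := Nat.exists_eq_add_of_le' hN1
    have h0 : Matrix.toLin' y v = 0 := by
      have := hv.apply_eq_smul
      rw [hy, map_sub, map_smul, Matrix.toLin'_one, LinearMap.sub_apply, this]
      simp
    rw [LinearMap.mem_ker, pow_succ, Module.End.mul_apply, h0, map_zero]
  · intro h
    refine hi c ⟨N, ?_⟩
    rw [LinearMap.range_eq_bot] at h
    apply Matrix.toLin'.injective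
    rw [Matrix.toLin'_pow, h, map_zero]
  · rw [LinearMap.mem_ker] at hv ⊢
    rw [← Module.End.mul_apply, ← (hcomm j).eq, Module.End.mul_apply, hv, map_zero]
  · rintro _ ⟨v, rfl⟩
    exact ⟨Matrix.toLin' (x j) v, by
      rw [← Module.End.mul_apply, ← (hcomm j).eq, Module.End.mul_apply]⟩

theorem Gnr_subset_commTuples (k : Type*) [Field k] (n r : ℕ) :
    Gnr k n r ⊆ commTuples k n r :=
  letI := matTupleZariski k n r
  closure_minimal (fun _ hx => hx.1) (isClosed_commTuples k n r)

/-- Let `n, r ≥ 2` and suppose `C_r(Mat_m(k))` is irreducible for every `1 ≤ m < n`. Then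
`C_r(Mat_n(k)) = G_n^r ∪ (C_r(N_n) + (k I_n)^r)`. -/
theorem commTuples_eq_Gnr_union (k : Type*) [Field k] [IsAlgClosed k]
    (n r : ℕ) (hn : 2 ≤ n) (hr : 2 ≤ r)
    (h : ∀ m : ℕ, 1 ≤ m → m < n →
      letI := matTupleZariski k m r
      IsIrreducible (commTuples k m r)) :
    commTuples k n r = Gnr k n r ∪
      {y | ∃ x ∈ nilCommTuples k n r, ∃ lam : Fin r → k,
        y = fun i => x i + lam i • (1 : Matrix (Fin n) (Fin n) k)} := by
  refine Set.Subset.antisymm (fun x hx => ?_)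
    (Set.union_subset (Gnr_subset_commTuples k n r) ?_)
  · rcases nilpotent_sub_or_exists_isCompl (by omega) hx with hnil | ⟨p, q, hpq, hp, hq, hinv⟩
    · choose c hc using hnil
      refine Or.inr ⟨fun i => x i - c i • 1, ⟨hc, fun i j => ?_⟩, c, by simp⟩
      exact Commute.sub_left
        (Commute.sub_right (hx i j) ((Commute.one_right _).smul_right _))
        ((Commute.one_left _).smul_left _)
    · left
      obtain ⟨Ψ, hΨ, hsurj⟩ := exists_blockDiagonal_algHom hpq
      choose a b hab using fun i => hsurj (x i) (hinv i).1 (hinv i).2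
      have hdim : Module.finrank k p + Module.finrank k q = n := by
        simpa using Submodule.finrank_add_eq_of_isCompl hpq
      have hp' : 1 ≤ Module.finrank k p := Submodule.one_le_finrank_iff.2 hp
      have hq' : 1 ≤ Module.finrank k q := Submodule.one_le_finrank_iff.2 hq
      have hcomm : ∀ i j, (a i, b i) * (a j, b j) = (a j, b j) * (a i, b i) := fun i j =>
        hΨ (by rw [map_mul, map_mul, hab, hab, hx i j])
      have hmem := mem_Gnr_of_blocks (by omega : 0 < r) hdim Ψ hΨ (h _ hp' (by omega))
        (h _ hq' (by omega)) (fun i j => congrArg Prod.fst (hcomm i j))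
        (fun i j => congrArg Prod.snd (hcomm i j))
      simpa only [hab] using hmem
  · rintro _ ⟨x, ⟨-, hx⟩, c, rfl⟩ i j
    exact Commute.add_left
      (Commute.add_right (hx i j) ((Commute.one_right _).smul_right _))
      ((Commute.one_left _).smul_left _)
end

section
/- Let x, y ∈ Mat_n(k) be nilpotent matrices with xy = yx. Then the (not necessarily unital) associative k-subalgebra ⟨x, y⟩ of Mat_n(k) generated by x and y has dimension at most n − 1 as a k-vector space. -/
open Matrix

/-- Over an algebraically closed field, every endomorphism of a finite-dimensional vector space
commutes with an endomorphism having a cyclic vector. -/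
theorem Module.End.exists_commute_linearIndependent_pow_apply {k V : Type*} [Field k]
    [IsAlgClosed k] [AddCommGroup V] [Module k V] [FiniteDimensional k V] (f : Module.End k V) :
    ∃ (z : Module.End k V) (v : V), Commute z f ∧
      LinearIndependent k (fun i : Fin (Module.finrank k V) => (z ^ (i : ℕ)) v) := by
  classical
  obtain ⟨ι, _, p, hp, e, ⟨E₀⟩⟩ := Module.equiv_directSum_of_isTorsion
    (R := Polynomial k) (M := Module.AEval' f) (Module.AEval.isTorsion_of_finiteDimensional k V f)
  have hroot (i : ι) : ∃ a, (p i).IsRoot a :=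
    IsAlgClosed.exists_root _ (Polynomial.degree_pos_of_irreducible (hp i)).ne'
  choose a ha using hroot
  have hdvd (i : ι) : Associated (Polynomial.X - Polynomial.C (a i)) (p i) :=
    (Polynomial.irreducible_X_sub_C (a i)).associated_of_dvd (hp i)
      (Polynomial.dvd_iff_isRoot.2 (ha i))
  have hspan (i : ι) : Submodule.span (Polynomial k) {p i ^ e i} =
      Ideal.span {(Polynomial.X - Polynomial.C (a i)) ^ e i} :=
    (Ideal.span_singleton_eq_span_singleton.2 ((hdvd i).pow_pow)).symm
  let W := ∀ i, Polynomial k ⧸ Submodule.span (Polynomial k) {p i ^ e i}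
  let E₁ : Module.AEval' f ≃ₗ[Polynomial k] W :=
    E₀ ≪≫ₗ DirectSum.linearEquivFunOnFintype (Polynomial k) ι _
  let E : V ≃ₗ[k] W := Module.AEval'.of f ≪≫ₗ E₁.restrictScalars k
  have hE (v : V) : E (f v) = (Polynomial.X : Polynomial k) • E v := by
    change E₁ (Module.AEval'.of f (f v)) = _
    rw [← Module.AEval'.X_smul_of, map_smul]
    rfl
  have hfin : Module.finrank k V = ∑ i, e i := by
    have hfd (i : ι) : Module.Finite k (Polynomial k ⧸ Submodule.span (Polynomial k) {p i ^ e i}) :=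
      Module.Finite.of_surjective ((LinearMap.proj i : W →ₗ[k] _) ∘ₗ E.toLinearMap)
        ((Function.surjective_eval i).comp E.surjective)
    rw [E.finrank_eq, Module.finrank_pi_fintype]
    refine Finset.sum_congr rfl fun i _ => ?_
    rw [hspan i]
    exact finrank_quotient_span_eq_natDegree.trans (by simp)
  obtain ⟨d, hd⟩ : ∃ d : ι → k, Function.Injective d :=
    ⟨fun i => Infinite.natEmbedding k (Fintype.equivFin ι i), fun i j h => by
      simpa [Fin.val_inj] using h⟩
  let c (i : ι) : Polynomial k := Polynomial.X + Polynomial.C (d i - a i)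
  let ζ : W →ₗ[Polynomial k] W := LinearMap.pi fun i => c i • LinearMap.proj i
  let z : Module.End k V := E.symm.toLinearMap ∘ₗ ζ.restrictScalars k ∘ₗ E.toLinearMap
  have hz (v : V) : E (z v) = ζ (E v) := by simp [z]
  have hzpow (v : V) (j : ℕ) : E ((z ^ j) v) = fun i => c i ^ j • E v i := by
    induction j with
    | zero => simp
    | succ j ih =>
      rw [pow_succ', Module.End.mul_apply, hz, ih]
      funext i
      change c i • c i ^ j • E v i = _
      rw [pow_succ', mul_smul]
  refine ⟨z, E.symm fun i => Submodule.Quotient.mk 1, ?_, ?_⟩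
  · ext v
    apply E.injective
    simp [hE, hz]
  · rw [Fintype.linearIndependent_iff]
    intro g hg
    let q : Polynomial k := ∑ j : Fin (Module.finrank k V), Polynomial.monomial j (g j)
    have hqdvd (i : ι) : (Polynomial.X - Polynomial.C (d i)) ^ e i ∣ q := by
      have h1 := congrFun (congrArg E hg) i
      have h2 : (Submodule.Quotient.mk (q.comp (c i)) :
          Polynomial k ⧸ Submodule.span (Polynomial k) {p i ^ e i}) = 0 := by
        rw [map_zero, map_sum, Finset.sum_apply] at h1
        refine Eq.trans ?_ h1
        rw [← Submodule.mkQ_apply,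
          show q.comp (c i) = _ from map_sum (Polynomial.compRingHom (c i)) _ _,
          map_sum]
        refine Finset.sum_congr rfl fun j _ => ?_
        rw [map_smul, hzpow, LinearEquiv.apply_symm_apply, Polynomial.coe_compRingHom_apply,
          Polynomial.monomial_comp,
          ← Polynomial.smul_eq_C_mul]
        change _ = g j • c i ^ (j : ℕ) • Submodule.mkQ (Submodule.span (Polynomial k) {p i ^ e i}) 1
        rw [← map_smul (Submodule.mkQ _) (c i ^ (j : ℕ)), smul_eq_mul, mul_one]
        rfl
      rw [Submodule.Quotient.mk_eq_zero, hspan i, Ideal.mem_span_singleton] at h2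
      obtain ⟨r, hr⟩ := h2
      refine ⟨r.comp (Polynomial.X - Polynomial.C (d i - a i)), ?_⟩
      have := congrArg (fun s => s.comp (Polynomial.X - Polynomial.C (d i - a i))) hr
      have hsub : Polynomial.X - (Polynomial.C (d i) - Polynomial.C (a i)) - Polynomial.C (a i) =
          Polynomial.X - Polynomial.C (d i) := by ring
      simpa [Polynomial.comp_assoc, c, Polynomial.mul_comp, hsub] using this
    have hprod : ∏ i, (Polynomial.X - Polynomial.C (d i)) ^ e i ∣ q :=
      Finset.prod_dvd_of_coprime
        (fun i _ j _ hij => (Polynomial.pairwise_coprime_X_sub_C hd hij).pow)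
        fun i _ => hqdvd i
    have hq : q = 0 := by
      apply Polynomial.eq_zero_of_dvd_of_degree_lt hprod
      have hdeg : (∏ i, (Polynomial.X - Polynomial.C (d i)) ^ e i).degree =
          (Module.finrank k V : WithBot ℕ) := by
        rw [hfin, Polynomial.degree_prod]
        simp
      rw [hdeg, Polynomial.degree_lt_iff_coeff_zero]
      intro m hm
      rw [Polynomial.finsetSum_coeff]
      exact Finset.sum_eq_zero fun j _ =>
        Polynomial.coeff_monomial_of_ne _ (j.2.trans_le hm).ne'
    intro j
    have := congrArg (fun s => s.coeff (j : ℕ)) hq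
    simpa [q, Polynomial.coeff_monomial, Fin.val_inj] using this

/-- Linear independence of a polynomial family of matrices, after applying a linear map, is an
open condition on the parameter. -/
theorem Matrix.finite_setOf_not_linearIndependent_eval {k m ι W : Type*} [Field k] [Fintype m]
    [DecidableEq m] [Finite ι] [AddCommGroup W] [Module k W]
    (G : ι → Matrix m m (Polynomial k)) (L : Matrix m m k →ₗ[k] W)
    (h : LinearIndependent k fun i => L ((Polynomial.evalRingHom 0).mapMatrix (G i))) :
    {t : k | ¬ LinearIndependent k
      fun i => L ((Polynomial.evalRingHom t).mapMatrix (G i))}.Finite := by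
  classical
  cases nonempty_fintype ι
  obtain ⟨φ, hφ⟩ := LinearMap.exists_leftInverse_of_injective _
    (LinearMap.ker_eq_bot.2 h)
  let D : Matrix ι ι (Polynomial k) := Matrix.of fun i j =>
    ∑ a, ∑ b, G i a b * Polynomial.C (φ (L (Matrix.single a b 1)) j)
  have hD (t : k) : (Polynomial.evalRingHom t).mapMatrix D =
      Matrix.of fun i j => φ (L ((Polynomial.evalRingHom t).mapMatrix (G i))) j := by
    ext i j
    rw [Matrix.of_apply]
    conv_rhs => rw [Matrix.matrix_eq_sum_single ((Polynomial.evalRingHom t).mapMatrix (G i))]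
    simp only [D, Matrix.of_apply, map_sum, Finsupp.finsetSum_apply, RingHom.mapMatrix_apply,
      Matrix.map_apply, map_mul]
    refine Finset.sum_congr rfl fun a _ => Finset.sum_congr rfl fun b _ => ?_
    have hsingle (r : k) : Matrix.single a b r = r • Matrix.single a b 1 := by
      rw [Matrix.smul_single, smul_eq_mul, mul_one]
    rw [hsingle (Polynomial.evalRingHom t (G i a b))]
    simp [-Matrix.smul_single]
  have hD0 : D.det ≠ 0 := by
    intro h0
    have h1 := congrArg (Polynomial.evalRingHom 0) h0
    rw [RingHom.map_det, hD] at h1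
    have : (Matrix.of fun i j => φ (L ((Polynomial.evalRingHom 0).mapMatrix (G i))) j) = 1 := by
      ext i j
      have := DFunLike.congr_fun (LinearMap.congr_fun hφ (Finsupp.single i 1)) j
      simpa [Matrix.one_apply, Finsupp.single_apply] using this
    rw [this] at h1
    simp at h1
  refine (D.det.roots.toFinset.finite_toSet).subset fun t ht => ?_
  by_contra hroot
  have hdet : ((Polynomial.evalRingHom t).mapMatrix D).det ≠ 0 := by
    rw [← RingHom.map_det]
    simpa [hD0] using hroot
  rw [hD] at hdet
  exact ht (LinearIndependent.of_comp (Finsupp.lcoeFun ∘ₗ φ)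
    (Matrix.linearIndependent_rows_of_det_ne_zero hdet))

/-- The Gerstenhaber theorem: the unital algebra generated by two commuting `n × n` matrices has
dimension at most `n`. -/
theorem Matrix.finrank_adjoin_pair_le_of_commute {k : Type*} [Field k] [IsAlgClosed k] {n : ℕ}
    {x y : Matrix (Fin n) (Fin n) k} (hxy : Commute x y) :
    Module.finrank k (Algebra.adjoin k ({x, y} : Set (Matrix (Fin n) (Fin n) k))) ≤ n := by
  obtain ⟨z', v, hz', hv⟩ :=
    Module.End.exists_commute_linearIndependent_pow_apply (Matrix.toLinAlgEquiv' x)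
  rw [Module.finrank_fin_fun] at hv
  obtain ⟨z, rfl⟩ := (Matrix.toLinAlgEquiv' (R := k) (n := Fin n)).surjective z'
  have hzx : Commute z x := by
    have := hz'.map (Matrix.toLinAlgEquiv' (R := k) (n := Fin n)).symm
    simpa using this
  let ι : Matrix (Fin n) (Fin n) k →+* Matrix (Fin n) (Fin n) (Polynomial k) :=
    Polynomial.C.mapMatrix
  have hι (t : k) (u) : (Polynomial.evalRingHom t).mapMatrix (ι u) = u := by
    ext; simp [ι]
  have hX (t : k) (u) : (Polynomial.evalRingHom t).mapMatrix
      ((Polynomial.X : Polynomial k) • ι u) = t • u := by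
    ext
    simpa [ι] using mul_comm _ _
  let Y := ι y + (Polynomial.X : Polynomial k) • ι z
  have hlift {u} (hu : u ∈ Algebra.adjoin k ({x, y} : Set (Matrix (Fin n) (Fin n) k))) :
      ∃ G, (Polynomial.evalRingHom 0).mapMatrix G = u ∧ Commute G Y := by
    induction hu using Algebra.adjoin_induction with
    | mem u hu =>
      rcases hu with rfl | rfl
      · exact ⟨ι u, hι 0 u, (hxy.map ι).add_right ((hzx.symm.map ι).smul_right _)⟩
      · exact ⟨Y, by rw [map_add, hι, hX, zero_smul, add_zero], Commute.refl _⟩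
    | algebraMap r =>
      refine ⟨ι (algebraMap k _ r), hι 0 _, ?_⟩
      exact ((show Commute _ y from Algebra.commutes r y).map ι).add_right
        (((show Commute _ z from Algebra.commutes r z).map ι).smul_right _)
    | add u w _ _ hu hw =>
      obtain ⟨G, hG, hGY⟩ := hu
      obtain ⟨H, hH, hHY⟩ := hw
      exact ⟨G + H, by rw [map_add, hG, hH], hGY.add_left hHY⟩
    | mul u w _ _ hu hw =>
      obtain ⟨G, hG, hGY⟩ := hu
      obtain ⟨H, hH, hHY⟩ := hw
      exact ⟨G * H, by rw [map_mul, hG, hH], hGY.mul_left hHY⟩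
  let b := Module.finBasis k (Algebra.adjoin k ({x, y} : Set (Matrix (Fin n) (Fin n) k)))
  choose G hG hGY using fun i => hlift (b i).2
  have hbad₁ := Matrix.finite_setOf_not_linearIndependent_eval G LinearMap.id (by
    simpa only [hG, LinearMap.id_apply] using!
      b.linearIndependent.map' (Subalgebra.val _).toLinearMap
        (LinearMap.ker_eq_bot.2 Subtype.val_injective))
  let ev : Matrix (Fin n) (Fin n) k →ₗ[k] (Fin n → k) := (Matrix.mulVecBilin k k).flip v
  have hev (u) : ev u = u *ᵥ v := rfl
  have hbad₂ := Matrix.finite_setOf_not_linearIndependent_eval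
    (fun i : Fin n => (ι z + (Polynomial.X : Polynomial k) • ι y) ^ (i : ℕ)) ev (by
      simpa only [map_pow, map_add, hι, hX, zero_smul, add_zero, hev, ← Matrix.toLinAlgEquiv'_apply]
        using hv)
  obtain ⟨t, ht⟩ := ((hbad₁.union (hbad₂.preimage inv_injective.injOn)).union
    (Set.finite_singleton (0 : k))).exists_notMem
  simp only [Set.mem_union, Set.mem_ofPred_eq, Set.mem_preimage, Set.mem_singleton_iff, not_or,
    not_not, map_pow, map_add, hι, hX, LinearMap.id_apply, hev] at ht
  obtain ⟨⟨hind, hcyc⟩, ht0⟩ := ht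
  set w := z + t⁻¹ • y with hw
  have hYw : (Polynomial.evalRingHom t).mapMatrix Y = t • w := by
    rw [map_add, hι, hX, hw, smul_add, smul_inv_smul₀ ht0, add_comm]
  let S : Submodule k (Matrix (Fin n) (Fin n) k) :=
    Subalgebra.toSubmodule (Subalgebra.centralizer k {w})
  have hS {u} : u ∈ S ↔ Commute w u := by
    simp [S, Subalgebra.mem_centralizer_iff, commute_iff_eq]
  have hmem (i) : (Polynomial.evalRingHom t).mapMatrix (G i) ∈ S := by
    have := (hGY i).map (Polynomial.evalRingHom t).mapMatrix
    rw [hYw] at this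
    rw [hS]
    simpa [smul_smul, inv_mul_cancel₀ ht0] using (this.smul_right t⁻¹).symm
  have hinj : Function.Injective (ev ∘ₗ S.subtype) := by
    rw [← LinearMap.ker_eq_bot, LinearMap.ker_eq_bot']
    rintro ⟨u, hu⟩ h0
    have h0 : u *ᵥ v = 0 := h0
    have hspan := hcyc.span_eq_top_of_card_eq_finrank' (by simp)
    have : Matrix.toLin' u = 0 := by
      apply LinearMap.ext_on_range hspan
      intro i
      rw [Matrix.toLin'_apply, Matrix.mulVec_mulVec, ← ((hS.1 hu).pow_left i).eq,
        ← Matrix.mulVec_mulVec, h0]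
      simp
    simpa using this
  have hind' : LinearIndependent k fun i => (⟨_, hmem i⟩ : S) :=
    LinearIndependent.of_comp S.subtype hind
  calc _ ≤ Module.finrank k S := by simpa using hind'.fintype_card_le_finrank
    _ ≤ Module.finrank k (Fin n → k) := LinearMap.finrank_le_finrank_of_injective hinj
    _ = n := Module.finrank_fin_fun k

/-- All elements of a non-unital algebra generated by commuting nilpotents are nilpotent. -/
theorem NonUnitalAlgebra.isNilpotent_of_mem_adjoin {R A : Type*} [CommRing R] [Ring A]
    [Algebra R A] {s : Set A} (hs : ∀ a ∈ s, IsNilpotent a)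
    (hcomm : ∀ a ∈ s, ∀ b ∈ s, Commute a b) {u : A} (hu : u ∈ NonUnitalAlgebra.adjoin R s) :
    IsNilpotent u := by
  have hc {a b : A} (ha : a ∈ NonUnitalAlgebra.adjoin R s)
      (hb : b ∈ NonUnitalAlgebra.adjoin R s) : Commute a b :=
    NonUnitalAlgebra.commute_of_mem_adjoin_of_forall_mem_commute hb fun c hc =>
      (NonUnitalAlgebra.commute_of_mem_adjoin_of_forall_mem_commute ha fun d hd =>
        hcomm c hc d hd).symm
  induction hu using NonUnitalAlgebra.adjoin_induction with
  | mem u hu => exact hs u hu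
  | add a b ha hb h₁ h₂ => exact (hc ha hb).isNilpotent_add h₁ h₂
  | zero => exact IsNilpotent.zero
  | mul a b ha hb h₁ h₂ => exact (hc ha hb).isNilpotent_mul_right h₁
  | smul r a _ h => exact h.smul r

/-- If `x, y` are commuting nilpotent `n × n` matrices, then the (not necessarily unital)
associative `k`-subalgebra generated by `x` and `y` has dimension at most `n - 1`. -/
theorem finrank_adjoin_pair_nilpotent_le (k : Type*) [Field k] [IsAlgClosed k] (n : ℕ)
    (x y : Matrix (Fin n) (Fin n) k) (hx : IsNilpotent x) (hy : IsNilpotent y)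
    (hxy : x * y = y * x) :
    Module.finrank k
      (NonUnitalAlgebra.adjoin k ({x, y} : Set (Matrix (Fin n) (Fin n) k))) ≤ n - 1 := by
  rcases Nat.eq_zero_or_pos n with rfl | hn
  · exact (Module.finrank_zero_of_subsingleton).le
  have : NeZero n := ⟨hn.ne'⟩
  have hle : NonUnitalAlgebra.adjoin k {x, y} ≤
      (Algebra.adjoin k {x, y}).toNonUnitalSubalgebra :=
    NonUnitalAlgebra.adjoin_le Algebra.subset_adjoin
  have hlt : (NonUnitalAlgebra.adjoin k {x, y}).toSubmodule <
      Subalgebra.toSubmodule (Algebra.adjoin k {x, y}) := by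
    refine lt_of_le_of_ne hle fun h => ?_
    have h1 : (1 : Matrix (Fin n) (Fin n) k) ∈ (NonUnitalAlgebra.adjoin k {x, y}).toSubmodule :=
      h ▸ one_mem (Algebra.adjoin k {x, y})
    refine not_isNilpotent_one (NonUnitalAlgebra.isNilpotent_of_mem_adjoin ?_ ?_ h1)
    · rintro a (rfl | rfl) <;> assumption
    · rintro a (rfl | rfl) b (rfl | rfl)
      exacts [Commute.refl _, hxy, hxy.symm, Commute.refl _]
  have h₁ := Submodule.finrank_lt_finrank_of_lt hlt
  have h₂ := Matrix.finrank_adjoin_pair_le_of_commute (show Commute x y from hxy)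
  exact Nat.le_sub_one_of_lt (h₁.trans_le h₂)
end
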